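/- Let q be an odd prime power, F a finite field with exactly q elements, and n ≥ 1. Then q^n ≤ k(Sp(2n,F)) ≤ 10.8 · q^n. Moreover k(Sp(2n,F)) ≤ q^n + 30 · q^{n−1}, and if q ≥ 5 then k(Sp(2n,F)) ≤ q^n + 12 · q^{n−1}. -/

import Mathlib

open scoped Matrix

/-- The matrix of the standard symplectic form: `[[0, Iₙ], [-Iₙ, 0]]`. -/
def sympJ (n : ℕ) (F : Type*) [Field F] :
    Matrix (Fin n ⊕ Fin n) (Fin n ⊕ Fin n) F :=
  Matrix.fromBlocks 0 1 (-1) 0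

/-- The symplectic group `Sp(2n, F)`: invertible `2n × 2n` matrices `A` with
`Aᵀ * J * A = J`, where `J = [[0, Iₙ], [-Iₙ, 0]]`. -/
def Sp (n : ℕ) (F : Type*) [Field F] :
    Subgroup (Matrix.GeneralLinearGroup (Fin n ⊕ Fin n) F) where
  carrier := {A | (A : Matrix (Fin n ⊕ Fin n) (Fin n ⊕ Fin n) F)ᵀ * sympJ n F *
      (A : Matrix (Fin n ⊕ Fin n) (Fin n ⊕ Fin n) F) = sympJ n F}
  one_mem' := by simp
  mul_mem' := by
    intro A B hA hB
    simp only [Set.mem_setOf_eq] at hA hB ⊢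
    rw [Units.val_mul, Matrix.transpose_mul]
    calc (B : Matrix _ _ F)ᵀ * (A : Matrix _ _ F)ᵀ * sympJ n F *
          ((A : Matrix _ _ F) * (B : Matrix _ _ F))
        = (B : Matrix _ _ F)ᵀ * ((A : Matrix _ _ F)ᵀ * sympJ n F * (A : Matrix _ _ F)) *
            (B : Matrix _ _ F) := by simp only [mul_assoc]
      _ = sympJ n F := by rw [hA, hB]
  inv_mem' := by
    intro A hA
    simp only [Set.mem_setOf_eq] at hA ⊢
    have h1 : (A : Matrix (Fin n ⊕ Fin n) (Fin n ⊕ Fin n) F) *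
        (↑A⁻¹ : Matrix (Fin n ⊕ Fin n) (Fin n ⊕ Fin n) F) = 1 := A.mul_inv
    conv_lhs => rw [← hA]
    calc (↑A⁻¹ : Matrix _ _ F)ᵀ * ((A : Matrix _ _ F)ᵀ * sympJ n F * (A : Matrix _ _ F)) *
          (↑A⁻¹ : Matrix _ _ F)
        = ((A : Matrix _ _ F) * (↑A⁻¹ : Matrix _ _ F))ᵀ * sympJ n F *
            ((A : Matrix _ _ F) * (↑A⁻¹ : Matrix _ _ F)) := by
          rw [Matrix.transpose_mul]; simp only [mul_assoc]
      _ = sympJ n F := by rw [h1]; simp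

section

open Polynomial

universe u

variable {F : Type*} [Field F]

/-- A functional on `F[X]` inducing a perfect pairing on `F[X]/(P)`. -/
structure IsFrobenius (P : F[X]) (l : F[X] →ₗ[F] F) : Prop where
  vanish : ∀ p, l (P * p) = 0
  dvd : ∀ a, (∀ p, l (a * p) = 0) → P ∣ a

theorem IsFrobenius.of_dvd_sub {P : F[X]} {l : F[X] →ₗ[F] F} (h : IsFrobenius P l) {a b : F[X]}
    (hab : P ∣ a - b) : l a = l b := by
  obtain ⟨c, hc⟩ := hab
  rw [← sub_eq_zero, ← map_sub, hc, h.vanish]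

theorem IsFrobenius.of_irreducible {E : F[X]} (hE : Irreducible E) {i : ℕ} (hi : 0 < i)
    {l : F[X] →ₗ[F] F} (h0 : ∀ p, l (E ^ i * p) = 0) {p : F[X]} (h1 : l (E ^ (i - 1) * p) ≠ 0) :
    IsFrobenius (E ^ i) l := by
  classical
  refine ⟨h0, fun a ha => ?_⟩
  by_contra hna
  obtain ⟨j, hj, hassoc⟩ := (dvd_prime_pow hE.prime i).1 (EuclideanDomain.gcd_dvd_right a (E ^ i))
  have hji : j < i := by
    rcases hj.lt_or_eq with h | h
    · exact h
    · exact absurd ((h ▸ hassoc.symm.dvd).trans (EuclideanDomain.gcd_dvd_left a (E ^ i))) hna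
  obtain ⟨c, hc⟩ := hassoc.dvd
  have hb := EuclideanDomain.gcd_eq_gcd_ab a (E ^ i)
  apply h1
  have hE1 : E ^ (i - 1) = E ^ (i - 1 - j) * E ^ j := by
    rw [← pow_add]; congr 1; omega
  have : E ^ (i - 1) * p = a * (EuclideanDomain.gcdA a (E ^ i) * c * E ^ (i - 1 - j) * p) +
      E ^ i * (EuclideanDomain.gcdB a (E ^ i) * c * E ^ (i - 1 - j) * p) := by
    linear_combination p * hE1 + E ^ (i - 1 - j) * p * hc + E ^ (i - 1 - j) * p * c * hb
  rw [this, map_add, ha, h0, add_zero]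

/-- The coefficient of `X ^ (deg P - 1)` in the remainder modulo `P`. -/
noncomputable def topCoeffMod (P : F[X]) : F[X] →ₗ[F] F :=
  lcoeff F (P.natDegree - 1) ∘ₗ modByMonicHom P

theorem topCoeffMod_isFrobenius {P : F[X]} (hP : P.Monic) (hd : 0 < P.natDegree) :
    IsFrobenius P (topCoeffMod P) := by
  have key : ∀ p, topCoeffMod P p = (p %ₘ P).coeff (P.natDegree - 1) := fun p => rfl
  refine ⟨fun p => ?_, fun a ha => ?_⟩
  · rw [key, mul_comm, mul_self_modByMonic hP]; simp
  · rw [← modByMonic_eq_zero_iff_dvd hP]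
    by_contra hr
    set r := a %ₘ P with hrdef
    have hlt : r.natDegree < P.natDegree :=
      natDegree_modByMonic_lt a hP (fun h => by simp [h] at hd)
    have h := ha (X ^ (P.natDegree - 1 - r.natDegree))
    have h2 : (a * X ^ (P.natDegree - 1 - r.natDegree)) %ₘ P =
        r * X ^ (P.natDegree - 1 - r.natDegree) := by
      have e1 : (a * X ^ (P.natDegree - 1 - r.natDegree)) %ₘ P =
          (r * X ^ (P.natDegree - 1 - r.natDegree)) %ₘ P := by
        rw [← sub_eq_zero, ← sub_modByMonic, modByMonic_eq_zero_iff_dvd hP, ← sub_mul]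
        refine Dvd.dvd.mul_right ?_ _
        refine ⟨a /ₘ P, ?_⟩
        rw [hrdef]
        linear_combination -(modByMonic_add_div a P)
      rw [e1, modByMonic_eq_self_iff hP]
      apply degree_lt_degree
      rw [natDegree_mul hr (by simp), natDegree_X_pow]
      omega
    rw [key, h2] at h
    have h3 : P.natDegree - 1 = r.natDegree + (P.natDegree - 1 - r.natDegree) := by omega
    rw [h3, Nat.add_sub_cancel_left, coeff_mul_X_pow] at h
    exact hr (leadingCoeff_eq_zero.1 h)

theorem IsFrobenius.exists_mul {P : F[X]} (hP0 : P ≠ 0) {l : F[X] →ₗ[F] F} (h : IsFrobenius P l)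
    {m : F[X] →ₗ[F] F} (hm : ∀ p, m (P * p) = 0) : ∃ u, ∀ p, m p = l (u * p) := by
  let I := (Ideal.span {P}).restrictScalars F
  have hle : ∀ k : F[X] →ₗ[F] F, (∀ p, k (P * p) = 0) → I ≤ LinearMap.ker k := by
    intro k hk x hx
    obtain ⟨c, rfl⟩ := Ideal.mem_span_singleton.1 (show x ∈ Ideal.span {P} from hx)
    exact hk c
  have hfd : FiniteDimensional F (F[X] ⧸ I) := by
    have : FiniteDimensional F (AdjoinRoot P) := by
      exact (AdjoinRoot.powerBasis hP0).finite
    exact this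
  let T : F[X] →ₗ[F] Module.Dual F (F[X] ⧸ I) :=
    { toFun := fun a => I.liftQ (l ∘ₗ LinearMap.mulLeft F a) (hle _ (fun p => by
        simp only [LinearMap.comp_apply, LinearMap.mulLeft_apply]
        rw [mul_left_comm, h.vanish]))
      map_add' := fun a b => by ext x; simp [add_mul]
      map_smul' := fun c a => by ext x; simp }
  have hker : I = LinearMap.ker T := by
    ext a
    rw [LinearMap.mem_ker]
    constructor
    · intro ha
      obtain ⟨c, rfl⟩ := Ideal.mem_span_singleton.1 (show a ∈ Ideal.span {P} from ha)
      ext x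
      simp [T, h.vanish]
    · intro ha
      refine Ideal.mem_span_singleton.2 (h.dvd a fun p => ?_)
      simpa [T] using LinearMap.congr_fun ha (I.mkQ p)
  have hsurj : LinearMap.range T = ⊤ := by
    apply Submodule.eq_top_of_finrank_eq
    rw [Subspace.dual_finrank_eq, ← LinearEquiv.finrank_eq T.quotKerEquivRange, ← hker]
  obtain ⟨u, hu⟩ := LinearMap.range_eq_top.1 hsurj (I.liftQ m (hle m hm))
  refine ⟨u, fun p => ?_⟩
  simpa [T] using (LinearMap.congr_fun hu (I.mkQ p)).symm

theorem IsFrobenius.not_dvd_of_mul {E : F[X]} (hE : Irreducible E) {i : ℕ} (hi : 0 < i)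
    {l m : F[X] →ₗ[F] F} (hl : IsFrobenius (E ^ i) l) (hm : IsFrobenius (E ^ i) m) {u : F[X]}
    (hu : ∀ p, m p = l (u * p)) : ¬ E ∣ u := by
  rintro ⟨c, rfl⟩
  have : E ^ i ∣ E ^ (i - 1) := hm.dvd _ fun p => by
    rw [hu, ← hl.vanish (c * p)]
    congr 1
    conv_rhs => rw [← Nat.sub_add_cancel hi, pow_succ]
    ring
  rw [pow_dvd_pow_iff hE.ne_zero hE.not_isUnit] at this
  omega

theorem exists_sq_dvd_sub {E : F[X]} (hE : Irreducible E) (h2 : (2 : F) ≠ 0) {u a : F[X]}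
    (ha : ¬ E ∣ a) (hu : E ∣ u - a ^ 2) {i : ℕ} (hi : 0 < i) :
    ∃ b, E ^ i ∣ u - b ^ 2 := by
  suffices h : ∃ b, ¬ E ∣ b ∧ E ^ i ∣ u - b ^ 2 from ⟨h.choose, h.choose_spec.2⟩
  induction i, hi using Nat.le_induction with
  | base => exact ⟨a, ha, by simpa using hu⟩
  | succ i hi ih =>
    obtain ⟨b, hb, s, hs⟩ := ih
    have hu2 : IsUnit (C (2 : F)) := isUnit_C.2 (isUnit_iff_ne_zero.2 h2)
    have hcop : IsCoprime (C 2 * b) E :=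
      IsCoprime.symm (((hE.coprime_iff_not_dvd).2 fun h =>
        hb ((hu2.dvd_mul_left).1 h)))
    obtain ⟨x, z, hxz⟩ := hcop
    refine ⟨b + E ^ i * (x * s), ?_, ?_⟩
    · intro h
      exact hb ((dvd_add_left ((dvd_pow_self E (by omega)).mul_right _)).1 h)
    · obtain ⟨k, rfl⟩ : ∃ k, i = k + 1 := ⟨i - 1, by omega⟩
      refine ⟨z * s - E ^ k * (x * s) ^ 2, ?_⟩
      have hC : (C (2:F)) = 2 := map_ofNat C 2
      rw [hC] at hxz
      linear_combination hs - E ^ (k+1) * s * hxz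

theorem exists_norm_dvd_sub [Fintype F] (h2 : (2 : F) ≠ 0) {E : F[X]} (hE : Irreducible E)
    {D u : F[X]} (hD : ¬ E ∣ D) (hu : ¬ E ∣ u) {i : ℕ} (hi : 0 < i) :
    ∃ a b, E ^ i ∣ u - (a ^ 2 - b ^ 2 * D) := by
  obtain ⟨a, b, hab⟩ : ∃ a b, E ∣ u - (a ^ 2 - b ^ 2 * D) := by
    have : Fact (Irreducible E) := ⟨hE⟩
    have : FiniteDimensional F (AdjoinRoot E) := (AdjoinRoot.powerBasis hE.ne_zero).finite
    have : Finite (AdjoinRoot E) := Module.finite_of_finite F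
    have := Fintype.ofFinite (AdjoinRoot E)
    have hD' : AdjoinRoot.mk E D ≠ 0 := by rwa [Ne, AdjoinRoot.mk_eq_zero]
    have hodd : Fintype.card (AdjoinRoot E) % 2 = 1 := by
      rw [← Nat.odd_iff, ← Nat.not_even_iff_odd]
      intro hev
      have h2' : ringChar (AdjoinRoot E) = 2 := by
        rw [FiniteField.even_card_iff_char_two, ← Nat.even_iff]; exact hev
      have h3 : ((2 : ℕ) : AdjoinRoot E) = 0 := (ringChar.spec _ _).2 (by rw [h2'])
      apply h2
      have h4 : algebraMap F (AdjoinRoot E) 2 = 0 := by rw [map_ofNat]; exact_mod_cast h3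
      exact (map_eq_zero _).1 h4
    obtain ⟨x, z, hxz⟩ := FiniteField.exists_root_sum_quadratic
      (f := X ^ 2 - C (AdjoinRoot.mk E u)) (g := C (-AdjoinRoot.mk E D) * X ^ 2)
      (degree_X_pow_sub_C (by norm_num) _) (degree_C_mul_X_pow 2 (neg_ne_zero.2 hD')) hodd
    obtain ⟨a, rfl⟩ := AdjoinRoot.mk_surjective x
    obtain ⟨b, rfl⟩ := AdjoinRoot.mk_surjective z
    refine ⟨a, b, ?_⟩
    rw [← AdjoinRoot.mk_eq_zero]
    simp only [eval_sub, eval_pow, eval_X, eval_C, eval_mul] at hxz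
    simp only [map_sub, map_pow, map_mul]
    linear_combination -hxz
  by_cases ha : E ∣ a
  · have hb : ¬ E ∣ b := by
      rintro ⟨c, rfl⟩
      obtain ⟨d, rfl⟩ := ha
      apply hu
      obtain ⟨e, he⟩ := hab
      exact ⟨e + d ^ 2 * E - E * c ^ 2 * D, by linear_combination he⟩
    obtain ⟨x, z, hxz⟩ := ((hE.coprime_iff_not_dvd.2 hD).pow_left (m := i))
    obtain ⟨b', hb'⟩ := exists_sq_dvd_sub hE h2 (u := (a ^ 2 - u) * z) hb (by
      obtain ⟨e, he⟩ := hab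
      obtain ⟨k, rfl⟩ : ∃ k, i = k + 1 := ⟨i - 1, by omega⟩
      exact ⟨- e * z - b ^ 2 * x * E ^ k, by linear_combination -z * he + b ^ 2 * hxz⟩) hi
    obtain ⟨e, he⟩ := hb'
    exact ⟨a, b', -D * e + (u - a ^ 2) * x, by linear_combination -D * he - (u - a ^ 2) * hxz⟩
  · obtain ⟨a', ha'⟩ := exists_sq_dvd_sub hE h2 (u := u + b ^ 2 * D) ha
      (by convert hab using 1; ring) hi
    exact ⟨a', b, by convert ha' using 1; ring⟩

/-- A nondegenerate alternating form `B` together with commuting endomorphisms, `y` self-adjoint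
and `δ` skew-adjoint, with `δ ^ 2 = y ^ 2 - 4`. Such triples are the same as isometries `g` of `B`,
via `y = g + g⁻¹` and `δ = g - g⁻¹`. -/
structure IsSympPair {F V : Type*} [Field F] [AddCommGroup V] [Module F V]
    (B : LinearMap.BilinForm F V) (y δ : Module.End F V) : Prop where
  alt : B.IsAlt
  nondeg : ∀ u, (∀ v, B u v = 0) → u = 0
  y_adj : ∀ u v, B (y u) v = B u (y v)
  δ_adj : ∀ u v, B (δ u) v = -B u (δ v)
  comm : ∀ v, δ (y v) = y (δ v)
  δ_sq : ∀ v, δ (δ v) = y (y v) - (4 : F) • v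

/-- A finite-dimensional symplectic space with an isometry, see `IsSympPair`. -/
structure SpObj (F : Type u) [Field F] where
  /-- the underlying space -/
  V : Type u
  [grp : AddCommGroup V]
  [mod : Module F V]
  [fin : FiniteDimensional F V]
  /-- the symplectic form -/
  B : LinearMap.BilinForm F V
  /-- the sum of the isometry and its inverse -/
  y : Module.End F V
  /-- the difference of the isometry and its inverse -/
  δ : Module.End F V
  symp : IsSympPair B y δ

attribute [instance] SpObj.grp SpObj.mod SpObj.fin

namespace SpObj

variable {F : Type u} [Field F]

/-- Isometric isomorphism. -/
def Iso (O O' : SpObj F) : Prop :=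
  ∃ e : O.V ≃ₗ[F] O'.V, (∀ u v, O'.B (e u) (e v) = O.B u v) ∧ (∀ v, e (O.y v) = O'.y (e v)) ∧
    ∀ v, e (O.δ v) = O'.δ (e v)

/-- Isometric isomorphism as an equivalence relation. -/
instance setoid (F : Type u) [Field F] : Setoid (SpObj F) where
  r := Iso
  iseqv :=
    { refl := fun O => ⟨LinearEquiv.refl F O.V, by simp⟩
      symm := fun ⟨e, h1, h2, h3⟩ => ⟨e.symm, fun u v => by rw [← h1]; simp,
        fun v => by rw [LinearEquiv.symm_apply_eq, h2]; simp,
        fun v => by rw [LinearEquiv.symm_apply_eq, h3]; simp⟩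
      trans := fun ⟨e, h1, h2, h3⟩ ⟨e', h1', h2', h3'⟩ => ⟨e.trans e', fun u v => by simp [h1', h1],
        fun v => by simp [h2, h2'], fun v => by simp [h3', h3]⟩ }

/-- The orthogonal direct sum. -/
def sum (O O' : SpObj F) : SpObj F where
  V := O.V × O'.V
  B := O.B.compl₁₂ (LinearMap.fst F _ _) (LinearMap.fst F _ _) +
    O'.B.compl₁₂ (LinearMap.snd F _ _) (LinearMap.snd F _ _)
  y := O.y.prodMap O'.y
  δ := O.δ.prodMap O'.δ
  symp :=
    { alt := fun v => by
        have h1 := O.symp.alt v.1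
        have h2 := O'.symp.alt v.2
        simp [h1, h2]
      nondeg := fun u hu => by
        refine Prod.ext (O.symp.nondeg _ fun v => ?_) (O'.symp.nondeg _ fun v => ?_)
        · simpa using hu (v, 0)
        · simpa using hu (0, v)
      y_adj := fun u v => by simp [O.symp.y_adj, O'.symp.y_adj]
      δ_adj := fun u v => by simp [O.symp.δ_adj, O'.symp.δ_adj, add_comm]
      comm := fun v => by simp [O.symp.comm, O'.symp.comm]
      δ_sq := fun v => by
        ext <;> simp [O.symp.δ_sq, O'.symp.δ_sq] }

/-- The zero space. -/
def zero (F : Type u) [Field F] : SpObj F where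
  V := PUnit.{u + 1}
  B := 0
  y := 0
  δ := 0
  symp := ⟨fun _ => rfl, fun _ _ => rfl, fun _ _ => rfl, fun _ _ => by simp, fun _ => rfl,
    fun _ => rfl⟩

theorem sum_B (O O' : SpObj F) (u v : O.V × O'.V) :
    (O.sum O').B u v = O.B u.1 v.1 + O'.B u.2 v.2 := rfl

/-- The restriction to a stable subspace meeting its orthogonal complement trivially. -/
def restrict (O : SpObj F) (U : Submodule F O.V) (hy : ∀ v ∈ U, O.y v ∈ U)
    (hδ : ∀ v ∈ U, O.δ v ∈ U) (hU : Disjoint U (O.B.orthogonal U)) : SpObj F where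
  V := U
  B := O.B.restrict U
  y := O.y.restrict hy
  δ := O.δ.restrict hδ
  symp :=
    { alt := fun v => O.symp.alt v
      nondeg := fun u hu => by
        have h : (u : O.V) ∈ O.B.orthogonal U := fun n hn =>
          O.symp.alt.isRefl u n (hu ⟨n, hn⟩)
        exact Subtype.ext (Submodule.disjoint_def.1 hU u u.2 h)
      y_adj := fun u v => O.symp.y_adj u v
      δ_adj := fun u v => O.symp.δ_adj u v
      comm := fun v => Subtype.ext (O.symp.comm v)
      δ_sq := fun v => Subtype.ext (O.symp.δ_sq v) }

theorem exists_iso_sum (O : SpObj F) (U : Submodule F O.V) (hy : ∀ v ∈ U, O.y v ∈ U)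
    (hδ : ∀ v ∈ U, O.δ v ∈ U) (hU : Disjoint U (O.B.orthogonal U)) :
    ∃ O' : SpObj F, O ≈ (O.restrict U hy hδ hU).sum O' := by
  have hc := (LinearMap.BilinForm.isCompl_orthogonal_iff_disjoint O.symp.alt.isRefl).2 hU
  have hy' : ∀ v ∈ O.B.orthogonal U, O.y v ∈ O.B.orthogonal U := fun v hv n hn => by
    have := hv _ (hy n hn)
    rwa [O.symp.y_adj] at this
  have hδ' : ∀ v ∈ O.B.orthogonal U, O.δ v ∈ O.B.orthogonal U := fun v hv n hn => by
    have := hv _ (hδ n hn)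
    rwa [O.symp.δ_adj, neg_eq_zero] at this
  have hU' : Disjoint (O.B.orthogonal U) (O.B.orthogonal (O.B.orthogonal U)) := by
    rw [Submodule.disjoint_def]
    intro x hx hx'
    refine O.symp.nondeg x fun v => ?_
    obtain ⟨a, ha, b, hb, rfl⟩ := Submodule.mem_sup.1 (hc.sup_eq_top ▸ Submodule.mem_top (x := v))
    rw [map_add, O.symp.alt.isRefl _ _ (hx a ha), O.symp.alt.isRefl _ _ (hx' b hb), add_zero]
  let e := Submodule.prodEquivOfIsCompl _ _ hc
  have he : ∀ a, e a = (a.1 : O.V) + a.2 := Submodule.coe_prodEquivOfIsCompl' _ _ hc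
  have key : ∀ a b, O.B (e a) (e b) = O.B a.1 b.1 + O.B a.2 b.2 := fun a b => by
    have h1 : O.B a.1 b.2 = 0 := b.2.2 _ a.1.2
    have h2 : O.B a.2 b.1 = 0 := O.symp.alt.isRefl _ _ (a.2.2 _ b.1.2)
    rw [he, he, map_add, map_add, LinearMap.add_apply, LinearMap.add_apply, h1, h2]
    simp
  refine ⟨O.restrict _ hy' hδ' hU', Setoid.symm ⟨e, key, fun v => ?_, fun v => ?_⟩⟩
  · exact (he _).trans ((map_add O.y _ _).symm.trans (congrArg O.y (he v)).symm)
  · exact (he _).trans ((map_add O.δ _ _).symm.trans (congrArg O.δ (he v)).symm)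

end SpObj

/-- Isometry classes of symplectic spaces with an isometry. -/
def SpClass (F : Type u) [Field F] : Type (u + 1) := Quotient (SpObj.setoid F)

namespace SpClass

variable {F : Type u} [Field F]

/-- The class of an object. -/
def mk (O : SpObj F) : SpClass F := Quotient.mk _ O

theorem mk_eq {O O' : SpObj F} : mk O = mk O' ↔ O.Iso O' := Quotient.eq

instance : Zero (SpClass F) := ⟨mk (SpObj.zero F)⟩

instance : Add (SpClass F) := ⟨Quotient.map₂ SpObj.sum (by
    rintro O O' ⟨e, h1, h2, h3⟩ P P' ⟨e', h1', h2', h3'⟩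
    refine ⟨e.prodCongr e', fun u v => ?_, fun v => Prod.ext (h2 v.1) (h2' v.2),
      fun v => Prod.ext (h3 v.1) (h3' v.2)⟩
    exact congrArg₂ (· + ·) (h1 u.1 v.1) (h1' u.2 v.2))⟩

instance : AddCommMonoid (SpClass F) where
  add_assoc := by
    rintro ⟨a⟩ ⟨b⟩ ⟨c⟩
    refine Quotient.sound ⟨LinearEquiv.prodAssoc F a.V b.V c.V, fun u v => ?_, fun v => rfl,
      fun v => rfl⟩
    exact (add_assoc _ _ _).symm
  add_comm := by
    rintro ⟨a⟩ ⟨b⟩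
    refine Quotient.sound ⟨LinearEquiv.prodComm F a.V b.V, fun u v => ?_, fun v => rfl,
      fun v => rfl⟩
    exact add_comm _ _
  zero_add := by
    rintro ⟨a⟩
    refine Quotient.sound ⟨(LinearEquiv.uniqueProd : (PUnit.{u + 1} × a.V) ≃ₗ[F] a.V),
      fun u v => ?_, fun v => rfl, fun v => rfl⟩
    exact (zero_add _).symm
  add_zero := by
    rintro ⟨a⟩
    refine Quotient.sound ⟨(LinearEquiv.prodUnique : (a.V × PUnit.{u + 1}) ≃ₗ[F] a.V),
      fun u v => ?_, fun v => rfl, fun v => rfl⟩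
    exact (add_zero _).symm
  nsmul := nsmulRec

theorem mk_sum (O O' : SpObj F) : mk (O.sum O') = mk O + mk O' := rfl

/-- The dimension of the underlying space. -/
noncomputable def dim : SpClass F →+ ℕ where
  toFun := Quotient.lift (fun O : SpObj F => Module.finrank F O.V) (by
    rintro O O' ⟨e, -⟩
    exact e.finrank_eq)
  map_zero' := Module.finrank_zero_of_subsingleton (R := F) (M := PUnit.{u + 1})
  map_add' := by
    rintro ⟨a⟩ ⟨b⟩
    exact Module.finrank_prod

theorem dim_mk (O : SpObj F) : dim (mk O) = Module.finrank F O.V := rfl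

theorem mk_eq_zero {O : SpObj F} (h : Module.finrank F O.V = 0) : mk O = 0 := by
  have : Subsingleton O.V := Module.finrank_zero_iff.1 h
  refine mk_eq.2 ⟨(0 : O.V ≃ₗ[F] PUnit.{u + 1}), fun u v => ?_, fun v => rfl, fun v => rfl⟩
  rw [Subsingleton.elim u 0, map_zero, LinearMap.zero_apply]
  rfl

end SpClass

/-- `X ^ 2 - 4`, the square of `δ` as a polynomial in `y`. -/
noncomputable def discPoly (F : Type*) [Field F] : F[X] := X ^ 2 - C 4

theorem map_aeval_of_comm {F V V' : Type*} [Field F] [AddCommGroup V] [Module F V]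
    [AddCommGroup V'] [Module F V'] {y : Module.End F V} {y' : Module.End F V'} (f : V →ₗ[F] V')
    (hf : ∀ v, f (y v) = y' (f v)) (p : F[X]) (v : V) : f (aeval y p v) = aeval y' p (f v) := by
  induction p using Polynomial.induction_on' with
  | add p q hp hq => simp [hp, hq]
  | monomial n a =>
    simp only [aeval_monomial, Module.algebraMap_end_eq_smul_id, Module.End.mul_apply,
      LinearMap.smul_apply, LinearMap.id_apply, map_smul]
    congr 1
    induction n with
    | zero => rfl
    | succ n ih => rw [pow_succ', pow_succ', Module.End.mul_apply, Module.End.mul_apply, ← ih, hf]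

namespace IsSympPair

variable {F V : Type*} [Field F] [AddCommGroup V] [Module F V] {B : LinearMap.BilinForm F V}
  {y δ : Module.End F V}

theorem neg_swap (h : IsSympPair B y δ) (u v : V) : B u v = -B v u := by
  have := h.alt.neg_eq v u
  simpa using this.symm

theorem aeval_adj (h : IsSympPair B y δ) (p : F[X]) (u v : V) :
    B (aeval y p u) v = B u (aeval y p v) := by
  induction p using Polynomial.induction_on' generalizing u v with
  | add p q hp hq => simp [hp, hq]
  | monomial n a =>
    simp only [aeval_monomial, Module.algebraMap_end_eq_smul_id, Module.End.mul_apply,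
      LinearMap.smul_apply, LinearMap.id_apply, map_smul, smul_eq_mul]
    congr 1
    induction n generalizing u v with
    | zero => simp
    | succ n ih => rw [pow_succ, Module.End.mul_apply, ih, h.y_adj, ← Module.End.mul_apply,
        (Commute.self_pow y n).eq]

theorem δ_aeval (h : IsSympPair B y δ) (p : F[X]) (v : V) :
    δ (aeval y p v) = aeval y p (δ v) :=
  map_aeval_of_comm δ h.comm p v

theorem aeval_mul_apply (p q : F[X]) (v : V) : aeval y (p * q) v = aeval y p (aeval y q v) := by
  simp

theorem δ_δ (h : IsSympPair B y δ) (v : V) : δ (δ v) = aeval y (discPoly F) v := by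
  rw [h.δ_sq]
  simp [discPoly, pow_two, Module.algebraMap_end_apply]

theorem aeval_self (h : IsSympPair B y δ) (h2 : (2 : F) ≠ 0) (p : F[X]) (v : V) :
    B v (aeval y p v) = 0 := by
  have h1 := h.neg_swap v (aeval y p v)
  rw [h.aeval_adj] at h1
  have : (2 : F) * B v (aeval y p v) = 0 := by linear_combination h1
  exact (mul_eq_zero.1 this).resolve_left h2

end IsSympPair

section GenMap

variable {F V : Type*} [Field F] [AddCommGroup V] [Module F V] {κ : Type*} [Fintype κ]

/-- The map `(a, b) ↦ ∑ k, a k (y) v k + δ (b k (y) v k)`. -/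
noncomputable def genMap (y δ : Module.End F V) (v : κ → V) : (κ → F[X] × F[X]) →ₗ[F] V :=
  ∑ k, ((LinearMap.applyₗ (v k) ∘ₗ (aeval y).toLinearMap ∘ₗ LinearMap.fst F _ _) +
    δ ∘ₗ LinearMap.applyₗ (v k) ∘ₗ (aeval y).toLinearMap ∘ₗ LinearMap.snd F _ _) ∘ₗ
      LinearMap.proj k

theorem genMap_apply (y δ : Module.End F V) (v : κ → V) (m : κ → F[X] × F[X]) :
    genMap y δ v m = ∑ k, (aeval y (m k).1 (v k) + δ (aeval y (m k).2 (v k))) := by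
  simp [genMap]

/-- The values of the form prescribed by Gram data, computed on formal combinations. -/
noncomputable def gram (G : κ → κ → (F[X] →ₗ[F] F) × (F[X] →ₗ[F] F))
    (m n : κ → F[X] × F[X]) : F :=
  ∑ k, ∑ l, ((G k l).1 ((m k).1 * (n l).1 - (m k).2 * (n l).2 * discPoly F) +
    (G k l).2 ((m k).1 * (n l).2 - (m k).2 * (n l).1))

/-- The vectors `v` have Gram data `G`. -/
structure HasGram (B : LinearMap.BilinForm F V) (y δ : Module.End F V) (v : κ → V)
    (G : κ → κ → (F[X] →ₗ[F] F) × (F[X] →ₗ[F] F)) : Prop where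
  fst : ∀ k l p, B (v k) (aeval y p (v l)) = (G k l).1 p
  snd : ∀ k l p, B (v k) (δ (aeval y p (v l))) = (G k l).2 p

variable {B : LinearMap.BilinForm F V} {y δ : Module.End F V} {v : κ → V}
  {G : κ → κ → (F[X] →ₗ[F] F) × (F[X] →ₗ[F] F)}

theorem HasGram.apply_genMap (hG : HasGram B y δ v G) (h : IsSympPair B y δ)
    (m n : κ → F[X] × F[X]) : B (genMap y δ v m) (genMap y δ v n) = gram G m n := by
  simp only [genMap_apply, gram, map_sum, LinearMap.sum_apply]
  rw [Finset.sum_comm]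
  refine Finset.sum_congr rfl fun k _ => Finset.sum_congr rfl fun l _ => ?_
  simp only [map_add, LinearMap.add_apply, map_sub, h.δ_adj, h.aeval_adj]
  rw [h.δ_δ, ← h.δ_aeval, ← h.δ_aeval]
  simp only [← IsSympPair.aeval_mul_apply, hG.fst, hG.snd]
  rw [mul_comm (discPoly F), mul_assoc]
  ring

theorem genMap_y (h : IsSympPair B y δ) (v : κ → V) (m : κ → F[X] × F[X]) :
    y (genMap y δ v m) = genMap y δ v (fun k => (X * (m k).1, X * (m k).2)) := by
  simp [genMap_apply, h.comm]

theorem genMap_δ (h : IsSympPair B y δ) (v : κ → V) (m : κ → F[X] × F[X]) :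
    δ (genMap y δ v m) = genMap y δ v (fun k => (discPoly F * (m k).2, (m k).1)) := by
  simp only [genMap_apply, h.δ_δ, map_sum, map_add, IsSympPair.aeval_mul_apply]
  simp only [add_comm]

end GenMap

namespace SpObj

variable {F : Type u} [Field F] {κ : Type*} [Fintype κ]

/-- `O` is generated by vectors with Gram data `G`. -/
def IsGen (G : κ → κ → (F[X] →ₗ[F] F) × (F[X] →ₗ[F] F)) (O : SpObj F) : Prop :=
  ∃ v : κ → O.V, HasGram O.B O.y O.δ v G ∧ Function.Surjective (genMap O.y O.δ v)

theorem genMap_eq_zero_iff {G : κ → κ → (F[X] →ₗ[F] F) × (F[X] →ₗ[F] F)} {O : SpObj F}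
    {v : κ → O.V} (hG : HasGram O.B O.y O.δ v G) (hs : Function.Surjective (genMap O.y O.δ v))
    (m : κ → F[X] × F[X]) : genMap O.y O.δ v m = 0 ↔ ∀ n, gram G m n = 0 := by
  constructor
  · intro hm n
    rw [← hG.apply_genMap O.symp, hm, map_zero, LinearMap.zero_apply]
  · intro hm
    refine O.symp.nondeg _ fun w => ?_
    obtain ⟨n, rfl⟩ := hs w
    rw [hG.apply_genMap O.symp, hm]

theorem IsGen.iso {G : κ → κ → (F[X] →ₗ[F] F) × (F[X] →ₗ[F] F)} {O O' : SpObj F}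
    (h : IsGen G O) (h' : IsGen G O') : O.Iso O' := by
  obtain ⟨v, hG, hs⟩ := h
  obtain ⟨v', hG', hs'⟩ := h'
  have hk : LinearMap.ker (genMap O.y O.δ v) = LinearMap.ker (genMap O'.y O'.δ v') := by
    ext m
    rw [LinearMap.mem_ker, LinearMap.mem_ker, genMap_eq_zero_iff hG hs,
      genMap_eq_zero_iff hG' hs']
  let e := ((genMap O.y O.δ v).quotKerEquivOfSurjective hs).symm.trans
    ((Submodule.quotEquivOfEq _ _ hk).trans
      ((genMap O'.y O'.δ v').quotKerEquivOfSurjective hs'))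
  have he : ∀ m, e (genMap O.y O.δ v m) = genMap O'.y O'.δ v' m := by
    intro m
    have : ((genMap O.y O.δ v).quotKerEquivOfSurjective hs).symm (genMap O.y O.δ v m) =
        Submodule.Quotient.mk m := by
      rw [LinearEquiv.symm_apply_eq]
      rfl
    simp only [e, LinearEquiv.trans_apply, this]
    rfl
  refine ⟨e, fun u w => ?_, fun w => ?_, fun w => ?_⟩
  · obtain ⟨m, rfl⟩ := hs u
    obtain ⟨n, rfl⟩ := hs w
    rw [he, he, hG.apply_genMap O.symp, hG'.apply_genMap O'.symp]
  · obtain ⟨n, rfl⟩ := hs w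
    rw [he, genMap_y O.symp, he, genMap_y O'.symp]
  · obtain ⟨n, rfl⟩ := hs w
    rw [he, genMap_δ O.symp, he, genMap_δ O'.symp]

theorem finrank_pi_adjoinRoot {F : Type*} [Field F] {P P' : F[X]} (hP : P ≠ 0) (hP' : P' ≠ 0) :
    Module.finrank F (κ → AdjoinRoot P × AdjoinRoot P') =
      Fintype.card κ * (P.natDegree + P'.natDegree) := by
  have h1 := (AdjoinRoot.powerBasis hP).finite
  have h2 := (AdjoinRoot.powerBasis hP').finite
  rw [Module.finrank_pi_fintype, Module.finrank_prod, (AdjoinRoot.powerBasis hP).finrank,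
    (AdjoinRoot.powerBasis hP').finrank]
  simp

/-- Vectors with sufficiently nondegenerate Gram data split off an orthogonal summand. -/
theorem exists_mk_add {G : κ → κ → (F[X] →ₗ[F] F) × (F[X] →ₗ[F] F)} (O : SpObj F)
    {v : κ → O.V} (hG : HasGram O.B O.y O.δ v G) {P P' : F[X]} (hP : P ≠ 0) (hP' : P' ≠ 0)
    (h1 : ∀ k, aeval O.y P (v k) = 0) (h2 : ∀ k, O.δ (aeval O.y P' (v k)) = 0)
    (hnd : ∀ m, (∀ n, gram G m n = 0) → ∀ k, P ∣ (m k).1 ∧ P' ∣ (m k).2) :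
    ∃ U O' : SpObj F, IsGen G U ∧
      Module.finrank F U.V = Fintype.card κ * (P.natDegree + P'.natDegree) ∧
      SpClass.mk O = SpClass.mk U + SpClass.mk O' := by
  have hzero : ∀ m : κ → F[X] × F[X], (∀ k, P ∣ (m k).1 ∧ P' ∣ (m k).2) →
      genMap O.y O.δ v m = 0 := by
    intro m hm
    rw [genMap_apply]
    refine Finset.sum_eq_zero fun k _ => ?_
    obtain ⟨⟨a, ha⟩, b, hb⟩ := hm k
    rw [ha, hb, mul_comm P, mul_comm P', IsSympPair.aeval_mul_apply, IsSympPair.aeval_mul_apply, h1,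
      O.symp.δ_aeval, h2]
    simp
  set U := LinearMap.range (genMap O.y O.δ v) with hU
  have hy : ∀ w ∈ U, O.y w ∈ U := by
    rintro _ ⟨m, rfl⟩
    exact ⟨_, (genMap_y O.symp v m).symm⟩
  have hδ : ∀ w ∈ U, O.δ w ∈ U := by
    rintro _ ⟨m, rfl⟩
    exact ⟨_, (genMap_δ O.symp v m).symm⟩
  have hdvd : ∀ m : κ → F[X] × F[X], (∀ n, gram G m n = 0) ↔
      ∀ k, P ∣ (m k).1 ∧ P' ∣ (m k).2 := by
    refine fun m => ⟨hnd m, fun hm n => ?_⟩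
    rw [← hG.apply_genMap O.symp, hzero m hm, map_zero, LinearMap.zero_apply]
  have hdisj : Disjoint U (O.B.orthogonal U) := by
    rw [Submodule.disjoint_def]
    rintro _ ⟨m, rfl⟩ hm
    refine hzero m ((hdvd m).1 fun n => ?_)
    rw [← hG.apply_genMap O.symp]
    exact O.symp.alt.isRefl _ _ (hm _ ⟨n, rfl⟩)
  obtain ⟨O', hO'⟩ := O.exists_iso_sum U hy hδ hdisj
  have hv : ∀ k, v k ∈ U := fun k => by
    classical
    refine ⟨Pi.single k (1, 0), ?_⟩
    rw [genMap_apply, Finset.sum_eq_single k]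
    · simp
    · intro l _ hl
      simp [Pi.single_eq_of_ne hl]
    · simp
  let v' : κ → (O.restrict U hy hδ hdisj).V := fun k => (⟨v k, hv k⟩ : U)
  let ι : (O.restrict U hy hδ hdisj).V →ₗ[F] O.V := U.subtype
  have haeval : ∀ (p : F[X]) (w : (O.restrict U hy hδ hdisj).V),
      ι (aeval (O.restrict U hy hδ hdisj).y p w) = aeval O.y p (ι w) :=
    map_aeval_of_comm ι fun _ => rfl
  have hgen : ∀ m, ι (genMap (O.restrict U hy hδ hdisj).y (O.restrict U hy hδ hdisj).δ v' m) =
      genMap O.y O.δ v m := by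
    intro m
    rw [genMap_apply, genMap_apply]
    refine (map_sum ι _ _).trans (Finset.sum_congr rfl fun k _ => ?_)
    refine (map_add ι _ _).trans (congrArg₂ (· + ·) (haeval _ _) ?_)
    exact congrArg O.δ (haeval _ _)
  refine ⟨O.restrict U hy hδ hdisj, O', ⟨v', ⟨fun k l p => ?_, fun k l p => ?_⟩, ?_⟩, ?_,
    SpClass.mk_eq.2 hO'⟩
  · rw [← hG.fst k l p, show v l = ι (v' l) from rfl, ← haeval]
    rfl
  · rw [← hG.snd k l p, show v l = ι (v' l) from rfl, ← haeval]
    rfl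
  · rintro ⟨_, m, rfl⟩
    exact ⟨m, Subtype.ext (hgen m)⟩
  · let ψ : (κ → F[X] × F[X]) →ₗ[F] (κ → AdjoinRoot P × AdjoinRoot P') :=
      LinearMap.pi fun k => ((AdjoinRoot.mkₐ P).toLinearMap.restrictScalars F).prodMap
        ((AdjoinRoot.mkₐ P').toLinearMap.restrictScalars F) ∘ₗ LinearMap.proj k
    have hψs : Function.Surjective ψ := by
      intro z
      choose a ha using fun k => AdjoinRoot.mk_surjective (z k).1
      choose b hb using fun k => AdjoinRoot.mk_surjective (z k).2
      exact ⟨fun k => (a k, b k), funext fun k => Prod.ext (ha k) (hb k)⟩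
    have hker : LinearMap.ker (genMap O.y O.δ v) = LinearMap.ker ψ := by
      ext m
      rw [LinearMap.mem_ker, LinearMap.mem_ker]
      have h3 : ψ m = 0 ↔ ∀ k, P ∣ (m k).1 ∧ P' ∣ (m k).2 := by
        rw [funext_iff]
        refine forall_congr' fun k => ?_
        rw [← AdjoinRoot.mk_eq_zero, ← AdjoinRoot.mk_eq_zero]
        exact Prod.ext_iff
      rw [h3, ← hdvd]
      refine ⟨fun hm n => ?_, fun hm => hzero m ((hdvd m).1 hm)⟩
      rw [← hG.apply_genMap O.symp, hm, map_zero, LinearMap.zero_apply]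
    rw [← finrank_pi_adjoinRoot hP hP']
    exact ((genMap O.y O.δ v).quotKerEquivRange.symm.trans
      ((Submodule.quotEquivOfEq _ _ hker).trans (ψ.quotKerEquivOfSurjective hψs))).finrank_eq

end SpObj

section Gram

variable {F : Type*} [Field F]

/-- Gram data of a cyclic piece. -/
noncomputable def gramCyclic (l : F[X] →ₗ[F] F) :
    Unit → Unit → (F[X] →ₗ[F] F) × (F[X] →ₗ[F] F) := fun _ _ => (0, l)

/-- Gram data of a hyperbolic piece. -/
noncomputable def gramHyp (l : F[X] →ₗ[F] F) :
    Bool → Bool → (F[X] →ₗ[F] F) × (F[X] →ₗ[F] F)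
  | false, true => (l, 0)
  | true, false => (-l, 0)
  | _, _ => 0

/-- Gram data of an orthogonal sum of two cyclic pieces. -/
noncomputable def gramDiag (l : F[X] →ₗ[F] F) :
    Bool → Bool → (F[X] →ₗ[F] F) × (F[X] →ₗ[F] F) := fun a b => if a = b then (0, l) else 0

theorem dvd_of_gramCyclic {P : F[X]} {l : F[X] →ₗ[F] F} (hl : IsFrobenius P l)
    {m : Unit → F[X] × F[X]} (hm : ∀ n, gram (gramCyclic l) m n = 0) (k : Unit) :
    P ∣ (m k).1 ∧ P ∣ (m k).2 := by
  constructor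
  · refine hl.dvd _ fun p => ?_
    simpa [gram, gramCyclic] using hm fun _ => (0, p)
  · refine hl.dvd _ fun p => ?_
    simpa [gram, gramCyclic] using hm fun _ => (-p, 0)

theorem dvd_of_gramHyp {E E' : F[X]} (hE : Irreducible E) (hD : discPoly F = E * E')
    (hE' : ¬E ∣ E') {i : ℕ} {l : F[X] →ₗ[F] F} (hl : IsFrobenius (E ^ (i + 1)) l)
    {m : Bool → F[X] × F[X]} (hm : ∀ n, gram (gramHyp l) m n = 0) (k : Bool) :
    E ^ (i + 1) ∣ (m k).1 ∧ E ^ i ∣ (m k).2 := by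
  constructor
  · refine hl.dvd _ fun p => ?_
    have := hm (Pi.single (!k) (p, 0))
    cases k <;> simpa [gram, gramHyp] using this
  · have h1 : E ^ (i + 1) ∣ (m k).2 * discPoly F := by
      refine hl.dvd _ fun p => ?_
      have := hm (Pi.single (!k) (0, p))
      rw [mul_right_comm]
      cases k <;> simpa [gram, gramHyp] using this
    rw [hD, pow_succ, mul_comm E, ← mul_assoc] at h1
    exact (hE.prime.pow_dvd_of_dvd_mul_right i hE' (mul_dvd_mul_iff_right hE.ne_zero |>.1 h1))

end Gram

namespace SpObj

variable {F : Type u} [Field F]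

theorem hasGram_cyclic (h2 : (2 : F) ≠ 0) {O : SpObj F} {l : F[X] →ₗ[F] F} {v : O.V}
    (hv : ∀ p : F[X], O.B v (O.δ (aeval O.y p v)) = l p) :
    HasGram O.B O.y O.δ (fun _ : Unit => v) (gramCyclic l) :=
  ⟨fun _ _ p => O.symp.aeval_self h2 p v, fun _ _ p => hv p⟩

theorem exists_cyclic_add (h2 : (2 : F) ≠ 0) (O : SpObj F) {P : F[X]} (hP : P ≠ 0)
    {l : F[X] →ₗ[F] F} (hl : IsFrobenius P l) {v : O.V} (h0 : aeval O.y P v = 0)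
    (hv : ∀ p : F[X], O.B v (O.δ (aeval O.y p v)) = l p) :
    ∃ U O' : SpObj F, IsGen (gramCyclic l) U ∧ Module.finrank F U.V = 2 * P.natDegree ∧
      SpClass.mk O = SpClass.mk U + SpClass.mk O' := by
  obtain ⟨U, O', h3, h4, h5⟩ := O.exists_mk_add (hasGram_cyclic h2 hv) hP hP (fun _ => h0)
    (fun _ => by rw [h0, map_zero]) (fun m hm k => dvd_of_gramCyclic hl hm k)
  exact ⟨U, O', h3, by rw [h4, Fintype.card_unit]; ring, h5⟩

theorem exists_hyp_add (h2 : (2 : F) ≠ 0) (O : SpObj F) {E E' : F[X]} (hE : Irreducible E)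
    (hD : discPoly F = E * E') (hE' : ¬E ∣ E') {i : ℕ} {l : F[X] →ₗ[F] F}
    (hl : IsFrobenius (E ^ (i + 1)) l) {v w : O.V}
    (hv : aeval O.y (E ^ (i + 1)) v = 0) (hw : aeval O.y (E ^ (i + 1)) w = 0)
    (hδv : O.δ (aeval O.y (E ^ i) v) = 0) (hδw : O.δ (aeval O.y (E ^ i) w) = 0)
    (hvv : ∀ p : F[X], O.B v (O.δ (aeval O.y p v)) = 0)
    (hww : ∀ p : F[X], O.B w (O.δ (aeval O.y p w)) = 0)
    (hvw : ∀ p : F[X], O.B v (aeval O.y p w) = l p)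
    (hvδw : ∀ p : F[X], O.B v (O.δ (aeval O.y p w)) = 0) :
    ∃ U O' : SpObj F, IsGen (gramHyp l) U ∧
      Module.finrank F U.V = 2 * ((2 * i + 1) * E.natDegree) ∧
      SpClass.mk O = SpClass.mk U + SpClass.mk O' := by
  have hG : HasGram O.B O.y O.δ (fun b : Bool => if b then w else v) (gramHyp l) := by
    constructor
    · rintro (_ | _) (_ | _) p
      · simpa [gramHyp] using O.symp.aeval_self h2 p v
      · simpa [gramHyp] using hvw p
      · rw [O.symp.neg_swap]
        simpa [gramHyp, O.symp.aeval_adj] using hvw p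
      · simpa [gramHyp] using O.symp.aeval_self h2 p w
    · rintro (_ | _) (_ | _) p
      · simpa [gramHyp] using hvv p
      · simpa [gramHyp] using hvδw p
      · have := hvδw p
        rw [O.symp.neg_swap]
        simpa [gramHyp, O.symp.δ_adj, O.symp.aeval_adj, O.symp.δ_aeval] using this
      · simpa [gramHyp] using hww p
  obtain ⟨U, O', h3, h4, h5⟩ := O.exists_mk_add hG (pow_ne_zero (i + 1) hE.ne_zero)
    (pow_ne_zero i hE.ne_zero) (by rintro (_ | _); exacts [hv, hw])
    (by rintro (_ | _); exacts [hδv, hδw])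
    (fun m hm k => dvd_of_gramHyp hE hD hE' hl hm k)
  exact ⟨U, O', h3, by rw [h4, Fintype.card_bool, natDegree_pow, natDegree_pow]; ring, h5⟩

theorem aeval_sum (O O' : SpObj F) (p : F[X]) (u : O.V) (v : O'.V) :
    aeval (O.sum O').y p ((u, v) : O.V × O'.V) = ((aeval O.y p u, aeval O'.y p v) : O.V × O'.V) :=
  Prod.ext
    (map_aeval_of_comm (y := (O.sum O').y) (y' := O.y) (LinearMap.fst F O.V O'.V)
      (fun _ => rfl) p (u, v))
    (map_aeval_of_comm (y := (O.sum O').y) (y' := O'.y) (LinearMap.snd F O.V O'.V)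
      (fun _ => rfl) p (u, v))

/-- Two isometric cyclic pieces together form a diagonal piece. -/
theorem isGen_diag (h2 : (2 : F) ≠ 0) {l : F[X] →ₗ[F] F} {c α β : F} (hc : (α ^ 2 + β ^ 2) * c = 1)
    {U U' : SpObj F} (hU : IsGen (gramCyclic (c • l)) U) (hU' : IsGen (gramCyclic (c • l)) U') :
    IsGen (gramDiag l) (U.sum U') := by
  obtain ⟨v, hv, hs⟩ := hU
  obtain ⟨v', hv', hs'⟩ := hU'
  let w : Bool → U.V × U'.V := fun b =>
    if b then (-(β • v ()), α • v' ()) else (α • v (), β • v' ())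
  refine ⟨w, ⟨?_, ?_⟩, ?_⟩
  · have e1 : ∀ p, U.B (v ()) (aeval U.y p (v ())) = 0 := fun p => U.symp.aeval_self h2 p _
    have e2 : ∀ p, U'.B (v' ()) (aeval U'.y p (v' ())) = 0 := fun p => U'.symp.aeval_self h2 p _
    rintro (_ | _) (_ | _) p <;> simp only [w] <;> simp [aeval_sum, sum_B, e1, e2, gramDiag]
  · have e1 : ∀ p, U.B (v ()) (U.δ (aeval U.y p (v ()))) = c * l p := fun p => hv.snd () () p
    have e2 : ∀ p, U'.B (v' ()) (U'.δ (aeval U'.y p (v' ()))) = c * l p :=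
      fun p => hv'.snd () () p
    have e3 : ∀ x : U.V × U'.V, (U.sum U').δ x = (U.δ x.1, U'.δ x.2) := fun _ => rfl
    rintro (_ | _) (_ | _) p <;> simp only [w] <;>
      simp [aeval_sum, sum_B, e1, e2, e3, gramDiag] <;> first
      | linear_combination (l p) * hc
      | linear_combination (-l p) * hc
      | ring
  · rintro ⟨x, x'⟩
    obtain ⟨m, rfl⟩ := hs x
    obtain ⟨m', rfl⟩ := hs' x'
    refine ⟨fun b => if b then c • (α • m' () - β • m ()) else c • (α • m () + β • m' ()), ?_⟩
    have e3 : ∀ x : U.V × U'.V, (U.sum U').δ x = (U.δ x.1, U'.δ x.2) := fun _ => rfl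
    have h1 : genMap U.y U.δ v m = ((α ^ 2 + β ^ 2) * c) • genMap U.y U.δ v m := by
      rw [hc, one_smul]
    have h1' : genMap U'.y U'.δ v' m' = ((α ^ 2 + β ^ 2) * c) • genMap U'.y U'.δ v' m' := by
      rw [hc, one_smul]
    rw [h1, h1', genMap_apply U.y, genMap_apply U'.y]
    refine (genMap_apply _ _ _ _).trans ((Fintype.sum_bool _).trans ?_)
    simp only [w, if_true, Bool.false_eq_true, if_false, aeval_sum, e3]
    have e4 : ∀ (a b : U.V) (a' b' : U'.V), (HAdd.hAdd (α := (U.sum U').V) (β := (U.sum U').V)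
      (a, a') (b, b') : (U.sum U').V) = (a + b, a' + b') := fun _ _ _ _ => rfl
    simp only [e4]
    refine Prod.ext ?_ ?_ <;> simp <;> module

end SpObj

theorem discPoly_eq {F : Type*} [Field F] (b : Bool) :
    discPoly F = (X - C (if b then 2 else -2)) * (X - C (if b then -2 else 2)) := by
  cases b <;> simp [discPoly, show (4 : F) = 2 * 2 by norm_num] <;> ring

theorem eq_of_dvd_discPoly {F : Type*} [Field F] {E : F[X]} (hE : Irreducible E) (hm : E.Monic)
    (h : E ∣ discPoly F) : ∃ b : Bool, E = X - C (if b then 2 else -2) := by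
  rw [discPoly_eq true] at h
  rcases hE.prime.dvd_or_dvd h with h | h
  · exact ⟨true, eq_of_monic_of_associated hm (monic_X_sub_C _)
      ((hE.dvd_irreducible_iff_associated (irreducible_X_sub_C _)).1 h)⟩
  · exact ⟨false, eq_of_monic_of_associated hm (monic_X_sub_C _)
      ((hE.dvd_irreducible_iff_associated (irreducible_X_sub_C _)).1 h)⟩

theorem not_X_sub_C_dvd {F : Type*} [Field F] (h2 : (2 : F) ≠ 0) (b : Bool) :
    ¬(X - C (if b then (2 : F) else -2)) ∣ X - C (if b then -2 else 2) := by
  rw [dvd_iff_isRoot]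
  have h4 : (2 : F) + 2 ≠ 0 := by
    rw [← two_mul]
    exact mul_ne_zero h2 h2
  cases b <;> simp [IsRoot]
  · intro h
    exact h4 (by linear_combination -h)
  · exact h4

/-- The functional `p ↦ B u (p(y) w)`. -/
noncomputable def pairing {F V : Type*} [Field F] [AddCommGroup V] [Module F V]
    (B : LinearMap.BilinForm F V) (y : Module.End F V) (u w : V) : F[X] →ₗ[F] F :=
  B u ∘ₗ LinearMap.applyₗ w ∘ₗ (aeval y).toLinearMap

namespace IsSympPair

variable {F V : Type*} [Field F] [AddCommGroup V] [Module F V] {B : LinearMap.BilinForm F V}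
  {y δ : Module.End F V}

theorem pairing_apply (u w : V) (p : F[X]) : pairing B y u w p = B u (aeval y p w) := rfl

theorem pairing_of_aeval_eq_zero {P : F[X]} {w : V} (hw : aeval y P w = 0) (u : V) (p : F[X]) :
    pairing B y u w (P * p) = 0 := by
  rw [pairing_apply, mul_comm, aeval_mul_apply, hw, map_zero, map_zero]

theorem pairing_swap (h : IsSympPair B y δ) (u w : V) (p : F[X]) :
    pairing B y u w p = -pairing B y w u p := by
  rw [pairing_apply, pairing_apply, h.neg_swap, h.aeval_adj]

theorem pairing_δ_swap (h : IsSympPair B y δ) (u w : V) (p : F[X]) :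
    pairing B y u (δ w) p = pairing B y w (δ u) p := by
  rw [h.pairing_swap, pairing_apply, pairing_apply, h.δ_adj, h.δ_aeval, neg_neg]

theorem pairing_scale (h : IsSympPair B y δ) (h2 : (2 : F) ≠ 0) (v : V) (a b p : F[X]) :
    pairing B y (aeval y a v + δ (aeval y b v)) (δ (aeval y a v + δ (aeval y b v))) p =
      pairing B y v (δ v) ((a ^ 2 - b ^ 2 * discPoly F) * p) := by
  have e : ∀ q, B v (aeval y q v) = 0 := fun q => h.aeval_self h2 q v
  simp only [pairing_apply, map_add, LinearMap.add_apply, h.δ_adj, h.aeval_adj, h.δ_aeval,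
    h.δ_δ, ← aeval_mul_apply, e]
  rw [show (a ^ 2 - b ^ 2 * discPoly F) * p = a * (p * a) - b * (p * (b * discPoly F)) by ring,
    map_sub, LinearMap.sub_apply, map_sub]
  ring

theorem exists_pairing_δ_ne_zero (h : IsSympPair B y δ) (h2 : (2 : F) ≠ 0) {q : F[X]} {w : V}
    (hw : δ (aeval y q w) ≠ 0) : ∃ v, pairing B y v (δ v) q ≠ 0 := by
  by_contra! hc
  refine hw ?_
  rw [h.δ_aeval]
  by_contra hne
  refine hne (h.nondeg _ fun u => ?_)
  rw [h.neg_swap]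
  have h1 := hc (u + w)
  have h3 := h.pairing_δ_swap u w q
  have h4 := hc u
  have h5 := hc w
  simp only [pairing_apply, map_add, LinearMap.add_apply] at h1 h3 h4 h5
  have : (2 : F) * B u (aeval y q (δ w)) = 0 := by linear_combination h1 - h4 - h5 + h3
  rw [(mul_eq_zero.1 this).resolve_left h2, neg_zero]

end IsSympPair

namespace IsSympPair

variable {F V : Type*} [Field F] [AddCommGroup V] [Module F V] {B : LinearMap.BilinForm F V}
  {y δ : Module.End F V}

/-- Vectors `v`, `w` generating, up to normalisation, a hyperbolic piece. -/
structure HypPair (B : LinearMap.BilinForm F V) (y δ : Module.End F V) (E : F[X]) (j : ℕ)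
    (v w : V) : Prop where
  left : aeval y (E ^ (j + 1)) v = 0
  right : aeval y (E ^ (j + 1)) w = 0
  δ_left : aeval y (E ^ j) (δ v) = 0
  δ_right : aeval y (E ^ j) (δ w) = 0
  ne : pairing B y v w (E ^ j) ≠ 0

variable {E E' : F[X]} {j : ℕ} {v w : V}

theorem HypPair.symm (hp : HypPair B y δ E j v w) (h : IsSympPair B y δ) :
    HypPair B y δ E j w v :=
  ⟨hp.right, hp.left, hp.δ_right, hp.δ_left, by
    rw [h.pairing_swap, neg_ne_zero]
    exact hp.ne⟩

theorem aeval_of_dvd {P Q : F[X]} (hPQ : P ∣ Q) (hv : aeval y P v = 0) : aeval y Q v = 0 := by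
  obtain ⟨c, rfl⟩ := hPQ
  rw [mul_comm, aeval_mul_apply, hv, map_zero]

theorem aeval_comm_apply (p q : F[X]) (v : V) :
    aeval y p (aeval y q v) = aeval y q (aeval y p v) := by
  rw [← aeval_mul_apply, mul_comm, aeval_mul_apply]

theorem HypPair.add (hp : HypPair B y δ E j v w) (h : IsSympPair B y δ)
    (hD : discPoly F = E * E') (s : F[X]) :
    HypPair B y δ E j (v + δ (aeval y s w)) w := by
  refine ⟨?_, hp.right, ?_, hp.δ_right, ?_⟩
  · rw [map_add, hp.left, h.δ_aeval, aeval_comm_apply, pow_succ', aeval_mul_apply, hp.δ_right]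
    simp
  · rw [map_add, map_add, hp.δ_left, h.δ_δ, ← aeval_mul_apply, ← aeval_mul_apply, zero_add]
    exact aeval_of_dvd ⟨E' * s, by rw [hD]; ring⟩ hp.right
  · have : pairing B y (v + δ (aeval y s w)) w (E ^ j) = pairing B y v w (E ^ j) := by
      rw [pairing_apply, pairing_apply, map_add, LinearMap.add_apply, h.δ_adj, h.δ_aeval,
        hp.δ_right]
      simp
    rw [this]
    exact hp.ne

/-- The functional `p ↦ B v (D p(y) w)` for a pair as above. -/
theorem HypPair.isFrobenius_disc (hp : HypPair B y δ E j v w) (h : IsSympPair B y δ)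
    (hE : Irreducible E)
    (hD : discPoly F = E * E') (hE' : ¬E ∣ E') (hj : 0 < j) :
    IsFrobenius (E ^ j) (pairing B y v (δ (δ w))) := by
  obtain ⟨a, b, hab⟩ := (hE.coprime_iff_not_dvd).2 hE'
  have hw : aeval y (E ^ j) (δ (δ w)) = 0 := by
    rw [← h.δ_aeval, hp.δ_right, map_zero]
  refine IsFrobenius.of_irreducible hE hj (p := b) (pairing_of_aeval_eq_zero hw v) ?_
  have h1 : E ^ (j - 1) * b * discPoly F = E ^ j - a * E ^ (j + 1) := by
    obtain ⟨k, rfl⟩ := Nat.exists_eq_add_of_lt hj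
    simp only [zero_add, Nat.add_sub_cancel, hD]
    linear_combination E ^ (k + 1) * hab
  rw [pairing_apply, h.δ_δ, ← aeval_mul_apply, h1, map_sub, LinearMap.sub_apply,
    aeval_mul_apply, hp.right,
    map_zero, sub_zero]
  exact hp.ne

theorem HypPair.isFrobenius (hp : HypPair B y δ E j v w) (hE : Irreducible E) :
    IsFrobenius (E ^ (j + 1)) (pairing B y v w) :=
  IsFrobenius.of_irreducible hE j.succ_pos (p := 1) (pairing_of_aeval_eq_zero hp.right v)
    (by simpa using hp.ne)

theorem pairing_add (h : IsSympPair B y δ) (s p : F[X]) :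
    pairing B y (v + δ (aeval y s w)) (δ (v + δ (aeval y s w))) p =
      pairing B y v (δ v) p + 2 * pairing B y v (δ (δ w)) (s * p) -
        pairing B y w (δ w) (discPoly F * s ^ 2 * p) := by
  have e := h.pairing_swap w v (s * p * discPoly F)
  simp only [pairing_apply, map_add, LinearMap.add_apply, h.δ_adj, h.aeval_adj, h.δ_aeval,
    h.δ_δ, ← aeval_mul_apply] at e ⊢
  rw [show p * (s * discPoly F) = s * p * discPoly F by ring,
    show s * (s * p * discPoly F) = discPoly F * s ^ 2 * p by ring, e]
  ring

theorem HypPair.exists_isotropic (h : IsSympPair B y δ) (h2 : (2 : F) ≠ 0) (hE : Irreducible E)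
    (hD : discPoly F = E * E') (hE' : ¬E ∣ E') (hp : HypPair B y δ E j v w) :
    ∃ v', HypPair B y δ E j v' w ∧ ∀ p, pairing B y v' (δ v') p = 0 := by
  suffices H : ∀ m ≤ j, ∀ v, HypPair B y δ E j v w →
      (∀ p, pairing B y v (δ v) (E ^ m * p) = 0) →
      ∃ v', HypPair B y δ E j v' w ∧ ∀ p, pairing B y v' (δ v') p = 0 from
    H j le_rfl v hp fun p => pairing_of_aeval_eq_zero hp.δ_left v p
  intro m
  induction m with
  | zero => exact fun _ v hp hv => ⟨v, hp, by simpa using hv⟩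
  | succ m ih =>
    intro hm v hp hv
    have hF := hp.isFrobenius_disc h hE hD hE' (by omega)
    obtain ⟨s, hs⟩ := hF.exists_mul (pow_ne_zero j hE.ne_zero)
      (m := (-(2 : F)⁻¹) • pairing B y v (δ v)) (fun p => by
        rw [LinearMap.smul_apply, ← Nat.add_sub_cancel' hm, pow_add, mul_assoc, hv, smul_zero])
    have hs' : ∀ p, 2 * pairing B y v (δ (δ w)) (s * p) = -pairing B y v (δ v) p := fun p => by
      rw [← hs, LinearMap.smul_apply, smul_eq_mul, ← mul_assoc, mul_neg, mul_inv_cancel₀ h2]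
      ring
    have hdvd : E ^ (j - (m + 1)) ∣ s := by
      have : E ^ j ∣ s * E ^ (m + 1) := hF.dvd _ fun p => by
        have := hs' (E ^ (m + 1) * p)
        rw [hv, neg_zero] at this
        rw [mul_assoc]
        exact (mul_eq_zero.1 this).resolve_left h2
      rw [← Nat.sub_add_cancel hm, pow_add] at this
      exact (mul_dvd_mul_iff_right (pow_ne_zero _ hE.ne_zero)).1 this
    refine ih (by omega) _ (hp.add h hD s) fun p => ?_
    obtain ⟨t, rfl⟩ := hdvd
    obtain ⟨k, rfl⟩ := Nat.exists_eq_add_of_le hm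
    rw [h.pairing_add, hs', add_neg_cancel, zero_sub, neg_eq_zero, hD]
    convert pairing_of_aeval_eq_zero hp.δ_right w (E ^ k * E' * t ^ 2 * p) using 2
    rw [Nat.add_sub_cancel_left]
    ring

theorem HypPair.add_self (hp : HypPair B y δ E j v w) (h : IsSympPair B y δ)
    (hD : discPoly F = E * E') (s : F[X]) :
    HypPair B y δ E j v (w + δ (aeval y s w)) := by
  refine ⟨hp.left, ?_, hp.δ_left, ?_, ?_⟩
  · rw [map_add, hp.right, h.δ_aeval, aeval_comm_apply, pow_succ', aeval_mul_apply, hp.δ_right]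
    simp
  · rw [map_add, map_add, hp.δ_right, h.δ_δ, ← aeval_mul_apply, ← aeval_mul_apply, zero_add]
    exact aeval_of_dvd ⟨E' * s, by rw [hD]; ring⟩ hp.right
  · have : pairing B y v (w + δ (aeval y s w)) (E ^ j) = pairing B y v w (E ^ j) := by
      rw [pairing_apply, pairing_apply, map_add, h.δ_aeval, aeval_comm_apply, hp.δ_right]
      simp
    rw [this]
    exact hp.ne

theorem HypPair.exists_normal (h : IsSympPair B y δ) (h2 : (2 : F) ≠ 0) (hE : Irreducible E)
    (hD : discPoly F = E * E') (hE' : ¬E ∣ E') (hp : HypPair B y δ E j v w)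
    {l : F[X] →ₗ[F] F} (hl : IsFrobenius (E ^ (j + 1)) l) :
    ∃ v w, aeval y (E ^ (j + 1)) v = 0 ∧ aeval y (E ^ (j + 1)) w = 0 ∧
      aeval y (E ^ j) (δ v) = 0 ∧ aeval y (E ^ j) (δ w) = 0 ∧
      (∀ p, pairing B y v (δ v) p = 0) ∧ (∀ p, pairing B y w (δ w) p = 0) ∧
      (∀ p, pairing B y v w p = l p) ∧ ∀ p, pairing B y v (δ w) p = 0 := by
  obtain ⟨v, hp, hv⟩ := hp.exists_isotropic h h2 hE hD hE'
  obtain ⟨w, hp, hw⟩ := (hp.symm h).exists_isotropic h h2 hE hD hE'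
  replace hp := hp.symm h
  obtain ⟨s, hs⟩ : ∃ s : F[X], ∀ p, pairing B y v (δ (w + δ (aeval y s w))) p = 0 := by
    have key : ∀ s p : F[X], pairing B y v (δ (w + δ (aeval y s w))) p =
        pairing B y v (δ w) p + pairing B y v (δ (δ w)) (s * p) := fun s p => by
      simp only [pairing_apply, map_add, h.δ_aeval, aeval_mul_apply]
      rw [aeval_comm_apply p s]
    rcases j.eq_zero_or_pos with rfl | hj
    · have h0 : δ w = 0 := by simpa using hp.δ_right
      exact ⟨0, fun p => by simp [h0, pairing_apply]⟩
    · obtain ⟨s, hs⟩ := (hp.isFrobenius_disc h hE hD hE' hj).exists_mul (pow_ne_zero j hE.ne_zero)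
        (m := -pairing B y v (δ w)) (fun p => by
          rw [LinearMap.neg_apply, pairing_of_aeval_eq_zero hp.δ_right, neg_zero])
      exact ⟨s, fun p => by rw [key, ← hs, LinearMap.neg_apply, add_neg_cancel]⟩
  replace hw : ∀ p, pairing B y (w + δ (aeval y s w)) (δ (w + δ (aeval y s w))) p = 0 := fun p => by
    have := h.pairing_scale h2 w 1 s p
    rwa [hw, map_one, Module.End.one_apply] at this
  replace hp := hp.add_self h hD s
  generalize w + δ (aeval y s w) = w at hw hs hp
  obtain ⟨t, ht⟩ := (hp.isFrobenius hE).exists_mul (pow_ne_zero _ hE.ne_zero) hl.vanish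
  refine ⟨v, aeval y t w, hp.left, ?_, hp.δ_left, ?_, hv, fun p => ?_, fun p => ?_, fun p => ?_⟩
  · rw [aeval_comm_apply, hp.right, map_zero]
  · rw [h.δ_aeval, aeval_comm_apply, hp.δ_right, map_zero]
  · have := h.pairing_scale h2 w t 0 p
    simpa [hw] using this
  · rw [ht, pairing_apply, pairing_apply, mul_comm, aeval_mul_apply]
  · rw [h.δ_aeval, pairing_apply, ← aeval_mul_apply]
    exact hs _

end IsSympPair

/-- The linear polynomial with root `2` or `-2`. -/
noncomputable def linPoly (F : Type*) [Field F] (b : Bool) : F[X] := X - C (if b then 2 else -2)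

theorem linPoly_monic {F : Type*} [Field F] (b : Bool) : (linPoly F b).Monic := monic_X_sub_C _

theorem linPoly_irreducible {F : Type*} [Field F] (b : Bool) : Irreducible (linPoly F b) :=
  irreducible_X_sub_C _

theorem natDegree_linPoly {F : Type*} [Field F] (b : Bool) : (linPoly F b).natDegree = 1 :=
  natDegree_X_sub_C _

namespace IsSympPair

variable {F V : Type*} [Field F] [AddCommGroup V] [Module F V] {B : LinearMap.BilinForm F V}
  {y δ : Module.End F V}

theorem exists_pairing_eq [Fintype F] (h : IsSympPair B y δ) (h2 : (2 : F) ≠ 0) {E : F[X]}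
    (hE : Irreducible E) (hD : ¬E ∣ discPoly F) {i : ℕ} (hi : 0 < i) {v : V}
    (h0 : aeval y (E ^ i) v = 0) (hv : IsFrobenius (E ^ i) (pairing B y v (δ v)))
    {l : F[X] →ₗ[F] F} (hl : IsFrobenius (E ^ i) l) :
    ∃ v, aeval y (E ^ i) v = 0 ∧ ∀ p, pairing B y v (δ v) p = l p := by
  obtain ⟨t, ht⟩ := hv.exists_mul (pow_ne_zero _ hE.ne_zero) hl.vanish
  obtain ⟨a, b, hab⟩ := exists_norm_dvd_sub h2 hE hD (hv.not_dvd_of_mul hE hi hl ht) hi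
  refine ⟨aeval y a v + δ (aeval y b v), ?_, fun p => ?_⟩
  · rw [map_add, ← h.δ_aeval, aeval_comm_apply _ a, aeval_comm_apply _ b, h0]
    simp
  · rw [h.pairing_scale h2, ht]
    refine (hv.of_dvd_sub ?_).symm
    rw [← sub_mul]
    exact hab.mul_right p

theorem exists_pairing_eq_smul (h : IsSympPair B y δ) (h2 : (2 : F) ≠ 0) {ε : F} (hε0 : ε ≠ 0)
    (hε : ∀ a : F, a ≠ 0 → ∃ s, a = s ^ 2 ∨ ε * a = s ^ 2) (b : Bool) {i : ℕ} (hi : 0 < i) {v : V}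
    (h0 : aeval y (linPoly F b ^ i) v = 0)
    (hv : IsFrobenius (linPoly F b ^ i) (pairing B y v (δ v)))
    {l : F[X] →ₗ[F] F} (hl : IsFrobenius (linPoly F b ^ i) l) :
    ∃ (c : Bool) (v : V), aeval y (linPoly F b ^ i) v = 0 ∧
      ∀ p, pairing B y v (δ v) p = ((if c then ε else 1) • l) p := by
  have hE := linPoly_irreducible (F := F) b
  obtain ⟨t, ht⟩ := hv.exists_mul (pow_ne_zero _ hE.ne_zero) hl.vanish
  have hnd := hv.not_dvd_of_mul hE hi hl ht
  rw [linPoly, dvd_iff_isRoot, IsRoot] at hnd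
  obtain ⟨c, s, hs⟩ : ∃ (c : Bool) (s : F),
      (if c then ε else 1) * t.eval (if b then 2 else -2) = s ^ 2 := by
    obtain ⟨s, hs | hs⟩ := hε _ hnd
    · exact ⟨false, s, by simpa using hs⟩
    · exact ⟨true, s, by simpa using hs⟩
  have hc : (if c then ε else 1) ≠ 0 := by cases c <;> simp [hε0]
  have hs0 : s ≠ 0 := by
    rintro rfl
    exact mul_ne_zero hc hnd (by simpa using hs)
  obtain ⟨r, hr⟩ := exists_sq_dvd_sub hE h2 (u := C (if c then ε else 1) * t) (a := C s)
    (by rw [linPoly, dvd_iff_isRoot]; simpa [IsRoot] using hs0)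
    (by rw [linPoly, dvd_iff_isRoot]; simpa [IsRoot, sub_eq_zero] using hs) hi
  refine ⟨c, aeval y r v, ?_, fun p => ?_⟩
  · rw [aeval_comm_apply, h0, map_zero]
  · have h1 := h.pairing_scale h2 v r 0 p
    rw [map_zero, LinearMap.zero_apply, map_zero, add_zero] at h1
    rw [h1, LinearMap.smul_apply, ht, ← map_smul]
    refine (hv.of_dvd_sub ?_).symm
    convert hr.mul_right p using 1
    rw [smul_eq_C_mul]
    ring

end IsSympPair

theorem IsFrobenius.smul {F : Type*} [Field F] {P : F[X]} {l : F[X] →ₗ[F] F}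
    (h : IsFrobenius P l) {c : F} (hc : c ≠ 0) : IsFrobenius P (c • l) :=
  ⟨fun p => by rw [LinearMap.smul_apply, h.vanish, smul_zero], fun a ha => h.dvd a fun p =>
    (smul_eq_zero.1 (ha p)).resolve_left hc⟩

namespace SpObj

open IsSympPair

variable {F : Type u} [Field F]

/-- Every nonzero object splits off one of the standard pieces. -/
theorem exists_piece [Fintype F] (h2 : (2 : F) ≠ 0) {ε : F} (hε0 : ε ≠ 0)
    (hε : ∀ a : F, a ≠ 0 → ∃ s, a = s ^ 2 ∨ ε * a = s ^ 2) (O : SpObj F)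
    (hO : Module.finrank F O.V ≠ 0) :
    ∃ U O' : SpObj F, SpClass.mk O = SpClass.mk U + SpClass.mk O' ∧
      ((∃ (E : F[X]) (i : ℕ), Irreducible E ∧ E.Monic ∧ ¬E ∣ discPoly F ∧
          IsGen (gramCyclic (topCoeffMod (E ^ (i + 1)))) U ∧
          Module.finrank F U.V = 2 * ((i + 1) * E.natDegree)) ∨
        (∃ (b : Bool) (j : ℕ), IsGen (gramHyp (topCoeffMod (linPoly F b ^ (j + 1)))) U ∧
          Module.finrank F U.V = 2 * (2 * j + 1)) ∨
        ∃ (b c : Bool) (j : ℕ),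
          IsGen (gramCyclic ((if c then ε else 1) • topCoeffMod (linPoly F b ^ (j + 1)))) U ∧
          Module.finrank F U.V = 2 * (j + 1)) := by
  have hnt : Nontrivial O.V := Module.finrank_pos_iff.1 (Nat.pos_of_ne_zero hO)
  have hm0 : minpoly F O.y ≠ 0 := minpoly.ne_zero (Algebra.IsIntegral.isIntegral O.y)
  have hmu : ¬IsUnit (minpoly F O.y) := minpoly.not_isUnit F O.y
  obtain ⟨E, hE, hEm, hEd⟩ : ∃ E : F[X], Irreducible E ∧ E.Monic ∧ E ∣ minpoly F O.y := by
    obtain ⟨E, hEm, hE, hd⟩ := Polynomial.exists_monic_irreducible_factor _ hmu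
    exact ⟨E, hE, hEm, hd⟩
  obtain ⟨i, r, hr, hmr⟩ : ∃ i r, ¬E ∣ r ∧ minpoly F O.y = E ^ (i + 1) * r := by
    obtain ⟨r, hmr, hr⟩ :=
      (FiniteMultiplicity.of_prime_left hE.prime hm0).exists_eq_pow_mul_and_not_dvd
    refine ⟨multiplicity E (minpoly F O.y) - 1, r, hr, ?_⟩
    rwa [Nat.sub_add_cancel]
    rw [Nat.one_le_iff_ne_zero]
    intro h
    rw [h, pow_zero, one_mul] at hmr
    exact hr (hmr ▸ hEd)
  have hkill : ∀ v, aeval O.y (E ^ (i + 1) * r ^ 2) v = 0 := fun v => by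
    refine aeval_of_dvd (P := minpoly F O.y) ?_ (by rw [minpoly.aeval]; rfl)
    exact ⟨r, by rw [hmr]; ring⟩
  have hEpos : 0 < E.natDegree := hE.natDegree_pos
  have hEi : 0 < (E ^ (i + 1)).natDegree := by
    rw [natDegree_pow]
    positivity
  have hFr := topCoeffMod_isFrobenius (hEm.pow (i + 1)) hEi
  by_cases hA : ∃ w, O.δ (aeval O.y (E ^ i * (r ^ 2) ^ 2) w) ≠ 0
  · obtain ⟨w, hw⟩ := hA
    obtain ⟨v, hv⟩ := O.symp.exists_pairing_δ_ne_zero h2 hw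
    have h0 : aeval O.y (E ^ (i + 1)) (aeval O.y (r ^ 2) v) = 0 := by
      rw [← aeval_mul_apply, hkill]
    have hvF : IsFrobenius (E ^ (i + 1))
        (pairing O.B O.y (aeval O.y (r ^ 2) v) (O.δ (aeval O.y (r ^ 2) v))) := by
      refine IsFrobenius.of_irreducible hE i.succ_pos (p := 1)
        (pairing_of_aeval_eq_zero (by rw [← O.symp.δ_aeval, h0, map_zero]) _) ?_
      convert hv using 1
      rw [pairing_apply, pairing_apply, O.symp.aeval_adj, O.symp.δ_aeval, ← aeval_mul_apply,
        ← aeval_mul_apply]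
      congr 3
      simp only [Nat.succ_eq_add_one, Nat.add_sub_cancel]
      ring
    by_cases hED : E ∣ discPoly F
    · obtain ⟨b, rfl⟩ := eq_of_dvd_discPoly hE hEm hED
      obtain ⟨c, v, h0, hv⟩ := O.symp.exists_pairing_eq_smul h2 hε0 hε b i.succ_pos h0 hvF hFr
      have hc : (if c then ε else 1) ≠ 0 := by cases c <;> simp [hε0]
      obtain ⟨U, O', h3, h4, h5⟩ := O.exists_cyclic_add h2 ((hEm.pow (i + 1)).ne_zero)
        (hFr.smul hc) h0 (fun p => by rw [O.symp.δ_aeval]; exact hv p)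
      refine ⟨U, O', h5, Or.inr (Or.inr ⟨b, c, i, h3, ?_⟩)⟩
      rw [h4, natDegree_pow, natDegree_X_sub_C, mul_one]
    · obtain ⟨v, h0, hv⟩ := O.symp.exists_pairing_eq h2 hE hED i.succ_pos h0 hvF hFr
      obtain ⟨U, O', h3, h4, h5⟩ := O.exists_cyclic_add h2 ((hEm.pow (i + 1)).ne_zero)
        hFr h0 (fun p => by rw [O.symp.δ_aeval]; exact hv p)
      exact ⟨U, O', h5, Or.inl ⟨E, i, hE, hEm, hED, h3, by rw [h4, natDegree_pow]⟩⟩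
  · push Not at hA
    have hr' : ∀ k, ¬E ∣ r ^ k := fun k hk => hr (hE.prime.dvd_of_dvd_pow hk)
    have hED : E ∣ discPoly F := by
      have h1 : minpoly F O.y ∣ discPoly F * (E ^ i * (r ^ 2) ^ 2) := by
        refine minpoly.dvd F _ (LinearMap.ext fun w => ?_)
        rw [aeval_mul_apply, ← O.symp.δ_δ, hA, map_zero, LinearMap.zero_apply]
      have h3 : E ^ i * E ∣ E ^ i * (discPoly F * r ^ 4) := by
        refine (Dvd.intro r ?_).trans (h1.trans (dvd_of_eq ?_))
        · rw [hmr]; ring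
        · ring
      have h4 := (mul_dvd_mul_iff_left (pow_ne_zero i hE.ne_zero)).1 h3
      exact (hE.prime.dvd_or_dvd h4).resolve_right (hr' 4)
    obtain ⟨w, hw⟩ : ∃ w, aeval O.y (E ^ i * ((r ^ 2) ^ 2) ^ 2) w ≠ 0 := by
      by_contra! hc
      have h1 : minpoly F O.y ∣ E ^ i * ((r ^ 2) ^ 2) ^ 2 :=
        minpoly.dvd F _ (LinearMap.ext hc)
      have h3 : E ^ i * E ∣ E ^ i * r ^ 8 := by
        refine (Dvd.intro r ?_).trans (h1.trans (dvd_of_eq ?_))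
        · rw [hmr]; ring
        · ring
      exact hr' 8 ((mul_dvd_mul_iff_left (pow_ne_zero i hE.ne_zero)).1 h3)
    obtain ⟨v, hv⟩ : ∃ v, O.B v (aeval O.y (E ^ i * ((r ^ 2) ^ 2) ^ 2) w) ≠ 0 := by
      by_contra! hc
      exact hw (O.symp.nondeg _ fun v => by rw [O.symp.neg_swap, hc, neg_zero])
    obtain ⟨b, rfl⟩ := eq_of_dvd_discPoly hE hEm hED
    have hp : HypPair O.B O.y O.δ (linPoly F b) i (aeval O.y ((r ^ 2) ^ 2) v)
        (aeval O.y ((r ^ 2) ^ 2) w) := by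
      refine ⟨?_, ?_, ?_, ?_, ?_⟩
      · rw [← aeval_mul_apply]
        exact aeval_of_dvd ⟨r ^ 2, by rw [linPoly]; ring⟩ (hkill v)
      · rw [← aeval_mul_apply]
        exact aeval_of_dvd ⟨r ^ 2, by rw [linPoly]; ring⟩ (hkill w)
      · rw [← O.symp.δ_aeval, ← aeval_mul_apply]
        exact hA v
      · rw [← O.symp.δ_aeval, ← aeval_mul_apply]
        exact hA w
      · convert hv using 1
        rw [pairing_apply, O.symp.aeval_adj, ← aeval_mul_apply, ← aeval_mul_apply]
        congr 3
        rw [linPoly]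
        ring
    obtain ⟨v, w, h3, h4, h5, h6, h7, h8, h9, h10⟩ := hp.exists_normal O.symp h2 hE
      (discPoly_eq b) (not_X_sub_C_dvd h2 b) hFr
    obtain ⟨U, O', h11, h12, h13⟩ := O.exists_hyp_add h2 hE (discPoly_eq b) (not_X_sub_C_dvd h2 b)
      hFr h3 h4 (by rwa [O.symp.δ_aeval]) (by rwa [O.symp.δ_aeval])
      (fun p => by rw [O.symp.δ_aeval]; exact h7 p) (fun p => by rw [O.symp.δ_aeval]; exact h8 p)
      h9 (fun p => by rw [O.symp.δ_aeval]; exact h10 p)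
    refine ⟨U, O', h13, Or.inr (Or.inl ⟨b, i, h11, ?_⟩)⟩
    rw [h12, natDegree_X_sub_C, mul_one]

end SpObj

namespace SpClass

variable {F : Type u} [Field F]

open SpObj

/-- The class generated by vectors with Gram data `G`, or `0` if there is none. -/
noncomputable def gen {κ : Type*} [Fintype κ]
    (G : κ → κ → (F[X] →ₗ[F] F) × (F[X] →ₗ[F] F)) : SpClass F :=
  open Classical in if h : ∃ U, IsGen G U then mk h.choose else 0

theorem gen_eq {κ : Type*} [Fintype κ] {G : κ → κ → (F[X] →ₗ[F] F) × (F[X] →ₗ[F] F)}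
    {U : SpObj F} (hU : IsGen G U) : gen G = mk U := by
  have h : ∃ U, IsGen G U := ⟨U, hU⟩
  rw [gen, dif_pos h]
  exact mk_eq.2 (h.choose_spec.iso hU)

/-- The class attached to a monic irreducible polynomial `E` and `k`, of dimension
`2 (k + 1) deg E`. -/
noncomputable def elem (E : F[X]) (k : ℕ) : SpClass F :=
  open Classical in
  if E ∣ discPoly F then
    if Even k then gen (gramHyp (topCoeffMod (E ^ (k / 2 + 1))))
    else gen (gramDiag (topCoeffMod (E ^ (k / 2 + 1))))
  else gen (gramCyclic (topCoeffMod (E ^ (k + 1))))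

/-- The class of the exceptional cyclic pieces, of dimension `2 (j + 1)`. -/
noncomputable def exc (ε : F) (j : ℕ) (b c : Bool) : SpClass F :=
  gen (gramCyclic ((if c then ε else 1) • topCoeffMod (linPoly F b ^ (j + 1))))

theorem linPoly_dvd (b : Bool) : linPoly F b ∣ discPoly F := ⟨_, discPoly_eq b⟩

theorem _root_.Ring.ringChar_ne_two {R : Type*} [Field R] (h2 : (2 : R) ≠ 0) :
    ringChar R ≠ 2 := fun h =>
  h2 (by exact_mod_cast (ringChar.spec R 2).2 h.dvd)

theorem exists_add [Fintype F] (h2 : (2 : F) ≠ 0) {ε : F} (hε0 : ε ≠ 0)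
    (hε : ∀ a : F, a ≠ 0 → ∃ s, a = s ^ 2 ∨ ε * a = s ^ 2) (x : SpClass F) (hx : dim x ≠ 0) :
    ∃ x', (∃ (E : F[X]) (k : ℕ), Irreducible E ∧ E.Monic ∧ x = elem E k + x' ∧
        dim x = 2 * ((k + 1) * E.natDegree) + dim x') ∨
      ∃ (j : ℕ) (b c : Bool), x = exc ε j b c + x' ∧
        exc ε j b c + exc ε j b c = elem (linPoly F b) (2 * j + 1) ∧
        dim x = 2 * (j + 1) + dim x' := by
  obtain ⟨O, rfl⟩ : ∃ O, x = mk O := ⟨x.out, (Quotient.out_eq x).symm⟩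
  obtain ⟨U, O', h, H⟩ := O.exists_piece h2 hε0 hε hx
  refine ⟨mk O', ?_⟩
  rw [h, map_add, dim_mk U]
  obtain ⟨E, i, hE, hm, hD, hg, hd⟩ | ⟨b, j, hg, hd⟩ | ⟨b, c, j, hg, hd⟩ := H
  · refine Or.inl ⟨E, i, hE, hm, ?_, by rw [hd]⟩
    rw [elem, if_neg hD, gen_eq hg]
  · refine Or.inl ⟨linPoly F b, 2 * j, linPoly_irreducible b, linPoly_monic b, ?_, ?_⟩
    · rw [elem, if_pos (linPoly_dvd b), if_pos (even_two_mul j),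
        Nat.mul_div_cancel_left j two_pos, gen_eq hg]
    · rw [hd, natDegree_linPoly, mul_one]
  · refine Or.inr ⟨j, b, c, ?_, ?_, by rw [hd]⟩
    · rw [exc, gen_eq hg]
    · have hc : (if c then ε else 1) ≠ 0 := by cases c <;> simp [hε0]
      obtain ⟨α, β, hαβ⟩ : ∃ α β : F, (α ^ 2 + β ^ 2) * (if c then ε else 1) = 1 := by
        obtain ⟨x, z, hxz⟩ := FiniteField.exists_root_sum_quadratic
          (f := X ^ 2 - C (if c then ε else 1)⁻¹) (g := X ^ 2)
          (degree_X_pow_sub_C (by norm_num) _) (degree_X_pow 2)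
          (FiniteField.odd_card_of_char_ne_two (Ring.ringChar_ne_two h2))
        refine ⟨x, z, ?_⟩
        simp only [eval_sub, eval_pow, eval_X, eval_C] at hxz
        rw [show x ^ 2 + z ^ 2 = (if c then ε else 1)⁻¹ by linear_combination hxz,
          inv_mul_cancel₀ hc]
      rw [elem, if_pos (linPoly_dvd b), if_neg (by simp), exc, gen_eq hg,
        show (2 * j + 1) / 2 = j by omega, gen_eq (isGen_diag h2 hαβ hg hg), mk_sum]

/-- The weight of combinatorial data. -/
noncomputable def weight {N : ℕ} (p : Fin N → F[X]) (S : Finset (Fin N × Bool × Bool)) : ℕ :=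
  ∑ k : Fin N, ((k : ℕ) + 1) * (p k).natDegree + ∑ s ∈ S, ((s.1 : ℕ) + 1)

open UniqueFactorizationMonoid in
/-- The class attached to combinatorial data. -/
noncomputable def ofData [DecidableEq F] (ε : F) {N : ℕ} (p : Fin N → F[X])
    (S : Finset (Fin N × Bool × Bool)) : SpClass F :=
  ∑ k : Fin N, ((normalizedFactors (p k)).map fun E => elem E k).sum +
    ∑ s ∈ S, exc ε s.1 s.2.1 s.2.2

theorem sum_update_mul {M : Type*} [AddCommMonoid M] {N : ℕ} (p : Fin N → F[X]) (k : Fin N)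
    (g : Fin N → F[X] → M) {Q : F[X]} {a : M} (h : g k Q = a + g k (p k)) :
    ∑ j, g j (Function.update p k Q j) = a + ∑ j, g j (p j) := by
  rw [Fintype.sum_eq_add_sum_compl k, Fintype.sum_eq_add_sum_compl k fun j => g j (p j),
    Function.update_self, h, add_assoc]
  congr 2
  refine Finset.sum_congr rfl fun j hj => ?_
  rw [Function.update_of_ne (by simpa using hj)]

theorem weight_update {N : ℕ} {p : Fin N → F[X]} (hp : ∀ k, (p k).Monic)
    (S : Finset (Fin N × Bool × Bool)) {E : F[X]} (hE : E.Monic) (k : Fin N) :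
    weight (Function.update p k (E * p k)) S = ((k : ℕ) + 1) * E.natDegree + weight p S := by
  rw [weight, sum_update_mul p k (fun k P => ((k : ℕ) + 1) * P.natDegree)
    (a := ((k : ℕ) + 1) * E.natDegree) (by rw [hE.natDegree_mul (hp k), mul_add]),
    weight, add_assoc]

theorem ofData_update [DecidableEq F] (ε : F) {N : ℕ} {p : Fin N → F[X]} (hp : ∀ k, (p k).Monic)
    (S : Finset (Fin N × Bool × Bool)) {E : F[X]} (hE : E.Monic) (hE' : Irreducible E)
    (k : Fin N) :
    ofData ε (Function.update p k (E * p k)) S = elem E k + ofData ε p S := by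
  rw [ofData, sum_update_mul p k (fun k P =>
    ((UniqueFactorizationMonoid.normalizedFactors P).map fun E => elem E k).sum)
    (a := elem E k) (by
      rw [UniqueFactorizationMonoid.normalizedFactors_mul hE'.ne_zero (hp k).ne_zero,
        UniqueFactorizationMonoid.normalizedFactors_irreducible hE', hE.normalize_eq_self]
      simp), ofData, add_assoc]

theorem update_monic {N : ℕ} {p : Fin N → F[X]} (hp : ∀ k, (p k).Monic) {E : F[X]} (hE : E.Monic)
    (k j : Fin N) : (Function.update p k (E * p k) j).Monic := by
  rw [Function.update_apply]
  split_ifs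
  · exact hE.mul (hp k)
  · exact hp j

theorem exists_ofData [Fintype F] [DecidableEq F] (h2 : (2 : F) ≠ 0) {ε : F} (hε0 : ε ≠ 0)
    (hε : ∀ a : F, a ≠ 0 → ∃ s, a = s ^ 2 ∨ ε * a = s ^ 2) {N n : ℕ} (hn : n ≤ N) (x : SpClass F)
    (hx : dim x = 2 * n) :
    ∃ (p : Fin N → F[X]) (S : Finset (Fin N × Bool × Bool)), (∀ k, (p k).Monic) ∧
      weight p S = n ∧ ofData ε p S = x := by
  induction n using Nat.strong_induction_on generalizing x with
  | _ n ih =>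
    rcases n.eq_zero_or_pos with rfl | hpos
    · refine ⟨fun _ => 1, ∅, fun _ => monic_one, by simp [weight], ?_⟩
      have : x = 0 := by
        obtain ⟨O, rfl⟩ : ∃ O, x = mk O := ⟨x.out, (Quotient.out_eq x).symm⟩
        exact mk_eq_zero hx
      simp [ofData, this]
    · obtain ⟨x', ⟨E, k, hE, hm, rfl, hd⟩ | ⟨j, b, c, rfl, hdd, hd⟩⟩ :=
        exists_add h2 hε0 hε x (by omega)
      · have hE1 := hE.natDegree_pos
        have hk : k + 1 ≤ (k + 1) * E.natDegree := Nat.le_mul_of_pos_right _ hE1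
        rw [hx] at hd
        generalize hD : (k + 1) * E.natDegree = D at *
        obtain ⟨p, S, hp, hw, hv⟩ := ih (n - D) (by omega) (by omega) x' (by omega)
        refine ⟨Function.update p ⟨k, by omega⟩ (E * p ⟨k, by omega⟩), S,
          update_monic hp hm _, ?_, ?_⟩
        · rw [weight_update hp S hm, hw, hD]
          omega
        · rw [ofData_update ε hp S hm hE, hv]
      · rw [hx] at hd
        obtain ⟨p, S, hp, hw, hv⟩ := ih (n - (j + 1)) (by omega) (by omega) x' (by omega)
        have hj : j < N := by omega
        by_cases hS : ((⟨j, hj⟩, b, c) : Fin N × Bool × Bool) ∈ S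
        · have h1 : weight p S = (j + 1) + weight p (S.erase (⟨j, hj⟩, b, c)) := by
            rw [weight, ← Finset.add_sum_erase S _ hS, weight]
            ring
          have hj' : 2 * j + 1 < N := by omega
          have h3 : exc ε j b c + ofData ε p (S.erase (⟨j, hj⟩, b, c)) = ofData ε p S := by
            rw [ofData, ofData, ← Finset.add_sum_erase S _ hS, add_left_comm]
          refine ⟨Function.update p ⟨2 * j + 1, hj'⟩ (linPoly F b * p ⟨2 * j + 1, hj'⟩),
            S.erase (⟨j, hj⟩, b, c), update_monic hp (linPoly_monic b) _, ?_, ?_⟩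
          · rw [weight_update hp _ (linPoly_monic b), natDegree_linPoly]
            simp only
            omega
          · rw [ofData_update ε hp _ (linPoly_monic b) (linPoly_irreducible b), ← hdd, ← hv,
              ← h3, add_assoc]
        · refine ⟨p, insert (⟨j, hj⟩, b, c) S, hp, ?_, ?_⟩
          · rw [weight, Finset.sum_insert hS]
            rw [weight] at hw
            simp only
            omega
          · rw [ofData, Finset.sum_insert hS, add_left_comm, ← hv, ofData]

end SpClass

section

variable {F : Type u} [Field F] {n : ℕ}

theorem sympJ_mul_sympJ : sympJ n F * sympJ n F = -1 := by
  rw [sympJ, Matrix.fromBlocks_multiply, ← Matrix.fromBlocks_one, Matrix.fromBlocks_neg]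
  simp

theorem Sp.transpose_mul_sympJ (A : Sp n F) :
    (A : Matrix.GeneralLinearGroup (Fin n ⊕ Fin n) F).1ᵀ * sympJ n F =
      sympJ n F * (A : Matrix.GeneralLinearGroup (Fin n ⊕ Fin n) F)⁻¹.1 := by
  have h : A.1.1ᵀ * sympJ n F * A.1.1 = sympJ n F := A.2
  rw [← mul_one (_ * _), ← A.1.mul_inv, ← mul_assoc, h]

theorem Sp.toBilin'_mulVec (A : Sp n F) (u v : Fin n ⊕ Fin n → F) :
    Matrix.toBilin' (sympJ n F) (A.1.1 *ᵥ u) v =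
      Matrix.toBilin' (sympJ n F) u (A.1⁻¹.1 *ᵥ v) := by
  rw [Matrix.toBilin'_apply', Matrix.toBilin'_apply', Matrix.mulVec_mulVec,
    ← Sp.transpose_mul_sympJ, ← Matrix.mulVec_mulVec, Matrix.mulVec_transpose,
    dotProduct_comm, Matrix.dotProduct_mulVec, dotProduct_comm]

theorem toBilin'_sympJ_isAlt : (Matrix.toBilin' (sympJ n F)).IsAlt := fun v => by
  rw [Matrix.toBilin'_apply', sympJ, Matrix.fromBlocks_mulVec, dotProduct,
    Fintype.sum_sum_type]
  simp [mul_comm, Matrix.neg_mulVec]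

/-- The symplectic space with isometry attached to a symplectic matrix. -/
noncomputable def SpObj.ofSp (A : Sp n F) : SpObj F where
  V := Fin n ⊕ Fin n → F
  B := Matrix.toBilin' (sympJ n F)
  y := Matrix.toLin' (A.1.1 + A.1⁻¹.1)
  δ := Matrix.toLin' (A.1.1 - A.1⁻¹.1)
  symp :=
    { alt := toBilin'_sympJ_isAlt
      nondeg := fun u hu => dotProduct_eq_zero_iff.1 fun w => by
        have h := hu (sympJ n F *ᵥ w)
        rwa [Matrix.toBilin'_apply', Matrix.mulVec_mulVec, sympJ_mul_sympJ, Matrix.neg_mulVec,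
          Matrix.one_mulVec, dotProduct_neg, neg_eq_zero] at h
      y_adj := fun u v => by
        have h := Sp.toBilin'_mulVec A⁻¹ u v
        simp only [Subgroup.coe_inv, inv_inv] at h
        simp only [Matrix.toLin'_apply, map_add, LinearMap.add_apply,
          Sp.toBilin'_mulVec, h]
        exact add_comm _ _
      δ_adj := fun u v => by
        have h := Sp.toBilin'_mulVec A⁻¹ u v
        simp only [Subgroup.coe_inv, inv_inv] at h
        simp only [Matrix.toLin'_apply, map_sub, LinearMap.sub_apply,
          Sp.toBilin'_mulVec, h]
        exact (neg_sub _ _).symm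
      comm := fun v => by
        simp only [Matrix.toLin'_apply, Matrix.mulVec_mulVec]
        congr 1
        have h1 := A.1.mul_inv
        have h2 := A.1.inv_mul
        rw [sub_mul, mul_add, mul_add, add_mul, mul_sub, mul_sub, h1, h2]
        abel
      δ_sq := fun v => by
        simp only [Matrix.toLin'_apply, Matrix.mulVec_mulVec]
        rw [show (4 : F) • v = ((4 : F) • (1 : Matrix (Fin n ⊕ Fin n) (Fin n ⊕ Fin n) F)) *ᵥ v by
          rw [Matrix.smul_mulVec, Matrix.one_mulVec], ← Matrix.sub_mulVec]
        congr 1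
        have h1 := A.1.mul_inv
        have h2 := A.1.inv_mul
        rw [sub_mul, add_mul, mul_add, mul_add, mul_sub, mul_sub, h1, h2,
          show (4 : F) = 1 + 1 + 1 + 1 by norm_num, add_smul, add_smul, add_smul, one_smul]
        abel }

theorem SpObj.ofSp_isConj (h2 : (2 : F) ≠ 0) {A A' : Sp n F}
    (h : (SpObj.ofSp A).Iso (SpObj.ofSp A')) : IsConj A A' := by
  obtain ⟨e, hB, hy, hδ⟩ := h
  change (Fin n ⊕ Fin n → F) ≃ₗ[F] (Fin n ⊕ Fin n → F) at e
  let T : Matrix.GeneralLinearGroup (Fin n ⊕ Fin n) F :=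
    ⟨LinearMap.toMatrix' e.toLinearMap, LinearMap.toMatrix' e.symm.toLinearMap,
      by rw [← LinearMap.toMatrix'_comp]; simp, by rw [← LinearMap.toMatrix'_comp]; simp⟩
  have hT : ∀ v, T.1 *ᵥ v = e v := fun v => by
    simp [T, ← Matrix.toLin'_apply]
  have hmem : T ∈ Sp n F := by
    change T.1ᵀ * sympJ n F * T.1 = sympJ n F
    apply Matrix.toBilin'.injective
    refine LinearMap.ext₂ fun u v => ?_
    have h := hB u v
    change Matrix.toBilin' (sympJ n F) (e u) (e v) = Matrix.toBilin' (sympJ n F) u v at h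
    rw [← h, ← hT, ← hT, Matrix.toBilin'_apply', Matrix.toBilin'_apply', ← Matrix.mulVec_mulVec,
      ← Matrix.mulVec_mulVec, Matrix.dotProduct_mulVec, Matrix.vecMul_transpose]
  rw [isConj_iff]
  refine ⟨⟨T, hmem⟩, ?_⟩
  rw [mul_inv_eq_iff_eq_mul]
  refine Subtype.ext (Units.ext ?_)
  change T.1 * A.1.1 = A'.1.1 * T.1
  apply Matrix.toLin'.injective
  refine LinearMap.ext fun v => ?_
  have h1 := hy v
  have h3 := hδ v
  change e ((A.1.1 + A.1⁻¹.1) *ᵥ v) = (A'.1.1 + A'.1⁻¹.1) *ᵥ e v at h1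
  change e ((A.1.1 - A.1⁻¹.1) *ᵥ v) = (A'.1.1 - A'.1⁻¹.1) *ᵥ e v at h3
  simp only [Matrix.toLin'_apply, ← Matrix.mulVec_mulVec, hT]
  rw [Matrix.add_mulVec, Matrix.add_mulVec, map_add] at h1
  rw [Matrix.sub_mulVec, Matrix.sub_mulVec, map_sub] at h3
  refine smul_right_injective _ h2 ?_
  simp only [two_smul]
  linear_combination (exp := 1) h1 + h3

end

section

variable {F : Type u} [Field F] {n : ℕ}

theorem SpClass.exists_nonsquare [Fintype F] (h2 : (2 : F) ≠ 0) :
    ∃ ε : F, ε ≠ 0 ∧ ∀ a : F, a ≠ 0 → ∃ s, a = s ^ 2 ∨ ε * a = s ^ 2 := by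
  obtain ⟨ε, hε⟩ := FiniteField.exists_nonsquare (Ring.ringChar_ne_two h2)
  have h0 : ε ≠ 0 := by
    rintro rfl
    exact hε ⟨0, by simp⟩
  refine ⟨ε, h0, fun a ha => ?_⟩
  by_cases hs : IsSquare a
  · obtain ⟨s, hs⟩ := hs
    exact ⟨s, Or.inl (by rw [hs, sq])⟩
  · classical
    have h3 : IsSquare (ε * a) := by
      rw [← quadraticChar_neg_one_iff_not_isSquare] at hε hs
      rw [← quadraticChar_one_iff_isSquare (mul_ne_zero h0 ha), map_mul, hε, hs]
      norm_num
    obtain ⟨s, hs⟩ := h3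
    exact ⟨s, Or.inr (by rw [hs, sq])⟩

/-- The monic polynomial with given lower coefficients. -/
noncomputable def monicOfCoeff {d : ℕ} (a : Fin d → F) : F[X] :=
  X ^ d + ∑ i : Fin d, C (a i) * X ^ (i : ℕ)

theorem Polynomial.Monic.monicOfCoeff_eq {p : F[X]} (hp : p.Monic) {d : ℕ} (hd : p.natDegree = d) :
    monicOfCoeff (fun i : Fin d => p.coeff i) = p := by
  subst hd
  rw [monicOfCoeff, Fin.sum_univ_eq_sum_range fun i => C (p.coeff i) * X ^ i]
  exact hp.as_sum.symm

/-- The degrees of combinatorial data of weight `n`. -/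
def degreeData (n : ℕ) : Finset ((Fin n → Fin (n + 1)) × Finset (Fin n × Bool × Bool)) :=
  {x | ∑ k : Fin n, ((k : ℕ) + 1) * (x.1 k : ℕ) + ∑ s ∈ x.2, ((s.1 : ℕ) + 1) = n}

theorem card_conjClasses_le [Fintype F] (h2 : (2 : F) ≠ 0) :
    Nat.card (ConjClasses (Sp n F)) ≤
      ∑ x ∈ degreeData n, Fintype.card F ^ ∑ k, (x.1 k : ℕ) := by
  classical
  obtain ⟨ε, hε0, hε⟩ := SpClass.exists_nonsquare h2
  have key : ∀ A : Sp n F, ∃ z : (Σ x : degreeData n, ∀ k, Fin (x.1.1 k : ℕ) → F),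
      SpClass.ofData ε (fun k => monicOfCoeff (z.2 k)) z.1.1.2 = SpClass.mk (SpObj.ofSp A) := by
    intro A
    obtain ⟨p, S, hp, hw, hv⟩ := SpClass.exists_ofData h2 hε0 hε le_rfl (SpClass.mk (SpObj.ofSp A))
      (show SpClass.dim _ = 2 * n by
        rw [SpClass.dim_mk]
        change Module.finrank F (Fin n ⊕ Fin n → F) = 2 * n
        simp [two_mul])
    have hd : ∀ k, (p k).natDegree < n + 1 := fun k => by
      rw [SpClass.weight] at hw
      have h1 := Finset.single_le_sum (f := fun k : Fin n => ((k : ℕ) + 1) * (p k).natDegree)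
        (fun _ _ => Nat.zero_le _) (Finset.mem_univ k)
      have h3 : (p k).natDegree ≤ ((k : ℕ) + 1) * (p k).natDegree :=
        Nat.le_mul_of_pos_left _ k.val.succ_pos
      omega
    refine ⟨⟨⟨(fun k => ⟨(p k).natDegree, hd k⟩, S),
      by simpa [degreeData, SpClass.weight] using hw⟩,
      fun k i => (p k).coeff i⟩, ?_⟩
    rw [← hv]
    congr 1
    funext k
    exact (hp k).monicOfCoeff_eq rfl
  choose z hz using key
  have hinj : Function.Injective fun c : ConjClasses (Sp n F) => z c.out := fun c c' h => by
    have h1 := hz c.out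
    simp only at h
    rw [h, hz] at h1
    rw [← Quotient.out_eq c, ← Quotient.out_eq c']
    exact Quotient.sound (SpObj.ofSp_isConj h2 (SpClass.mk_eq.1 h1.symm))
  refine (Nat.card_le_card_of_injective _ hinj).trans ?_
  rw [Nat.card_eq_fintype_card, Fintype.card_sigma, ← Finset.sum_coe_sort (degreeData n)]
  refine le_of_eq (Finset.sum_congr rfl fun x _ => ?_)
  rw [Fintype.card_pi, ← Finset.prod_pow_eq_pow_sum]
  simp

end

section

theorem mul_le_one_add {t u v a b : ℝ} (ht : 0 ≤ t) (ht' : t ≤ 1) (hv : 0 ≤ v)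
    (ha : 1 ≤ a) (hb : 1 ≤ b) (hua : u ≤ 1 + t * (a - 1)) (hvb : v ≤ 1 + t * (b - 1)) :
    u * v ≤ 1 + t * (a * b - 1) := by
  have h1 : 0 ≤ t * (a - 1) := mul_nonneg ht (by linarith)
  have h2 : 0 ≤ t * (1 - t) * ((a - 1) * (b - 1)) :=
    mul_nonneg (mul_nonneg ht (by linarith)) (mul_nonneg (by linarith) (by linarith))
  have h3 := mul_le_mul hua hvb hv (by linarith)
  linarith

/-- The generating product at `x`. -/
noncomputable def boundProd (x : ℝ) (n : ℕ) : ℝ :=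
  ∏ i ∈ Finset.range n, (1 + x ^ (i + 1)) ^ 4 / (1 - x ^ (i + 1))

theorem one_le_factor {y : ℝ} (h0 : 0 ≤ y) (h1 : y < 1) : 1 ≤ (1 + y) ^ 4 / (1 - y) := by
  rw [le_div_iff₀ (by linarith)]
  have := one_le_pow₀ (n := 4) (show 1 ≤ 1 + y by linarith)
  linarith

theorem one_le_boundProd {x : ℝ} (h0 : 0 ≤ x) (h1 : x < 1) (n : ℕ) : 1 ≤ boundProd x n :=
  Finset.one_le_prod fun i _ =>
    one_le_factor (pow_nonneg h0 _) (pow_lt_one₀ h0 h1 i.succ_ne_zero)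

theorem factor_le {t y z : ℝ} (ht : 0 ≤ t) (ht' : t ≤ 1) (hz : 0 ≤ z) (hz1 : z ≤ t * y)
    (hy : y < 1) (hy0 : 0 ≤ y) :
    (1 + z) ^ 4 / (1 - z) ≤ 1 + t * ((1 + y) ^ 4 / (1 - y) - 1) := by
  have hzy : z ≤ y := hz1.trans (mul_le_of_le_one_left hy0 ht')
  have h1 : 1 + z ≤ 1 + t * ((1 + y) - 1) := by linarith
  have hy1 : 1 ≤ 1 + y := by linarith
  have h2 := mul_le_one_add ht ht' (by linarith : 0 ≤ 1 + z) hy1 hy1 h1 h1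
  have h4 := mul_le_one_add ht ht' (by positivity) (one_le_mul_of_one_le_of_one_le hy1 hy1)
    (one_le_mul_of_one_le_of_one_le hy1 hy1) h2 h2
  have h5 : (1 - z)⁻¹ ≤ 1 + t * ((1 - y)⁻¹ - 1) := by
    have hy' : 0 < 1 - y := by linarith
    have hz' : 0 < 1 - z := by linarith
    have h6 : (1 - z)⁻¹ - 1 = z / (1 - z) := by field_simp; ring
    have h7 : (1 - y)⁻¹ - 1 = y / (1 - y) := by field_simp; ring
    have h8 : z / (1 - z) ≤ t * y / (1 - y) :=
      div_le_div₀ (mul_nonneg ht hy0) hz1 hy' (by linarith)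
    rw [h7, ← mul_div_assoc]
    linarith
  have h6 := mul_le_one_add ht ht' (inv_nonneg.2 (by linarith))
    (one_le_mul_of_one_le_of_one_le (one_le_mul_of_one_le_of_one_le hy1 hy1)
      (one_le_mul_of_one_le_of_one_le hy1 hy1)) (by
        rw [one_le_inv₀ (by linarith)]
        linarith) h4 h5
  convert h6 using 1
  · ring
  · ring

theorem boundProd_mul_le {t x : ℝ} (ht : 0 ≤ t) (ht' : t ≤ 1) (h0 : 0 ≤ x) (h1 : x < 1) (n : ℕ) :
    boundProd (t * x) n ≤ 1 + t * (boundProd x n - 1) := by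
  have hx : ∀ i : ℕ, x ^ (i + 1) < 1 := fun i => pow_lt_one₀ h0 h1 i.succ_ne_zero
  have htx : t * x < 1 := (mul_le_of_le_one_left h0 ht').trans_lt h1
  induction n with
  | zero => simp [boundProd]
  | succ n ih =>
    have h3 : (t * x) ^ (n + 1) ≤ t * x ^ (n + 1) := by
      rw [mul_pow]
      exact mul_le_mul_of_nonneg_right (pow_le_of_le_one ht ht' n.succ_ne_zero) (by positivity)
    have h4 := factor_le ht ht' (by positivity) h3 (hx n) (by positivity)
    have h5 := one_le_factor (pow_nonneg (mul_nonneg ht h0) (n + 1))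
      (pow_lt_one₀ (mul_nonneg ht h0) htx n.succ_ne_zero)
    rw [boundProd, boundProd, Finset.prod_range_succ, Finset.prod_range_succ]
    exact mul_le_one_add ht ht' (by linarith) (one_le_boundProd h0 h1 n)
      (one_le_factor (by positivity) (hx n)) ih h4

theorem boundProd_mono {x : ℝ} (h0 : 0 ≤ x) (h1 : x < 1) : Monotone (boundProd x) :=
  monotone_nat_of_le_succ fun n => by
    rw [boundProd, boundProd, Finset.prod_range_succ, ← boundProd]
    exact le_mul_of_one_le_right (by linarith [one_le_boundProd h0 h1 n])
      (one_le_factor (pow_nonneg h0 _) (pow_lt_one₀ h0 h1 n.succ_ne_zero))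

theorem boundProd_le {x a c : ℝ} {m : ℕ} (h0 : 0 < x) (h1 : x < 1) (ha : 0 ≤ a) (hc : 0 ≤ c)
    (hm : boundProd x m ≤ a * (1 - c * x ^ m))
    (hstep : ∀ t, 0 < t → t ≤ x ^ m → (1 - c * (t / x)) * (1 + t) ^ 4 ≤ (1 - c * t) * (1 - t))
    (n : ℕ) : boundProd x n ≤ a := by
  have key : ∀ k, boundProd x (k + m) ≤ a * (1 - c * x ^ (k + m)) := by
    intro k
    induction k with
    | zero => simpa using hm
    | succ k ih =>
      have ht1 : x ^ (k + m + 1) < 1 := pow_lt_one₀ h0.le h1 (by omega)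
      rw [show k + 1 + m = k + m + 1 by ring, boundProd, Finset.prod_range_succ, ← boundProd,
        ← mul_div_assoc, div_le_iff₀ (by linarith)]
      refine (mul_le_mul_of_nonneg_right ih (by positivity)).trans ?_
      have h2 := hstep (x ^ (k + m + 1)) (by positivity)
        (pow_le_pow_of_le_one h0.le h1.le (by omega))
      rw [pow_succ, mul_div_cancel_right₀ _ h0.ne', ← pow_succ] at h2
      rw [mul_assoc, mul_assoc]
      exact mul_le_mul_of_nonneg_left h2 ha
  refine ((boundProd_mono h0.le h1 (Nat.le_add_right n m)).trans (key n)).trans ?_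
  exact mul_le_of_le_one_right ha (by linarith [mul_nonneg hc (pow_nonneg h0.le (n + m))])

theorem boundProd_third (n : ℕ) : boundProd (1 / 3) n ≤ 10.8 := by
  refine boundProd_le (c := 3) (m := 5) (by norm_num) (by norm_num) (by norm_num) (by norm_num)
    (by norm_num [boundProd, Finset.prod_range_succ]) (fun t h0 h1 => ?_) n
  have h2 : t ≤ 1 / 9 := h1.trans (by norm_num)
  nlinarith [pow_pos h0 2, pow_pos h0 3, pow_pos h0 4]

theorem boundProd_fifth (n : ℕ) : boundProd (1 / 5) n ≤ 3.4 := by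
  refine boundProd_le (c := 2) (m := 3) (by norm_num) (by norm_num) (by norm_num) (by norm_num)
    (by norm_num [boundProd, Finset.prod_range_succ]) (fun t h0 h1 => ?_) n
  have h2 : t ≤ 1 / 9 := h1.trans (by norm_num)
  nlinarith [pow_pos h0 2, pow_pos h0 3, pow_pos h0 4]

theorem sum_pow_mul_le {x : ℝ} (h0 : 0 ≤ x) (h1 : x < 1) (m : ℕ) :
    ∑ y : (Fin m → Fin (m + 2)) × Finset (Fin (m + 1) × Bool × Bool),
      x ^ (∑ k : Fin m, ((k : ℕ) + 1) * (y.1 k : ℕ) + ∑ s ∈ y.2, ((s.1 : ℕ) + 1)) ≤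
        boundProd x (m + 1) := by
  have hx : ∀ i : ℕ, x ^ (i + 1) < 1 := fun i => pow_lt_one₀ h0 h1 i.succ_ne_zero
  have hA : ∑ d : Fin m → Fin (m + 2), x ^ ∑ k : Fin m, ((k : ℕ) + 1) * (d k : ℕ) ≤
      ∏ i ∈ Finset.range m, (1 - x ^ (i + 1))⁻¹ := by
    simp only [← Finset.prod_pow_eq_pow_sum]
    rw [← Fintype.piFinset_univ, ← Finset.prod_univ_sum (fun _ => Finset.univ)
      (fun (k : Fin m) (d : Fin (m + 2)) => x ^ (((k : ℕ) + 1) * (d : ℕ))),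
      Finset.prod_range fun i => (1 - x ^ (i + 1))⁻¹]
    refine Finset.prod_le_prod (fun k _ => by positivity) fun k _ => ?_
    simp only [pow_mul]
    rw [Fin.sum_univ_eq_sum_range fun d => (x ^ ((k : ℕ) + 1)) ^ d]
    exact (Summable.sum_le_tsum _ (fun _ _ => by positivity)
      (summable_geometric_of_lt_one (by positivity) (hx k))).trans
      (tsum_geometric_of_lt_one (by positivity) (hx k)).le
  have hB : ∑ S : Finset (Fin (m + 1) × Bool × Bool), x ^ ∑ s ∈ S, ((s.1 : ℕ) + 1) =
      ∏ i ∈ Finset.range (m + 1), (1 + x ^ (i + 1)) ^ 4 := by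
    simp only [← Finset.prod_pow_eq_pow_sum]
    rw [← Finset.powerset_univ, ← Finset.prod_one_add, Fintype.prod_prod_type,
      Finset.prod_range fun i => (1 + x ^ (i + 1)) ^ 4]
    simp
  rw [Fintype.sum_prod_type]
  simp only [pow_add x (Finset.sum _ _), ← Finset.mul_sum, ← Finset.sum_mul]
  rw [hB, boundProd, Finset.prod_div_distrib, div_eq_mul_inv, mul_comm, ← Finset.prod_inv_distrib,
    Finset.prod_range_succ fun i => (1 - x ^ (i + 1))⁻¹]
  refine mul_le_mul_of_nonneg_left (hA.trans (le_mul_of_one_le_right ?_ ?_)) ?_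
  · exact Finset.prod_nonneg fun i _ => inv_nonneg.2 (by linarith [hx i])
  · rw [one_le_inv₀ (by linarith [hx m])]
    linarith [pow_nonneg h0 (m + 1)]
  · positivity

theorem sum_degreeData_le {q : ℕ} (hq : 2 ≤ q) {n : ℕ} (hn : 1 ≤ n) :
    ∑ x ∈ degreeData n, (q : ℝ) ^ ∑ k, (x.1 k : ℕ) ≤ (q : ℝ) ^ n * boundProd (1 / q) n := by
  obtain ⟨m, rfl⟩ : ∃ m, n = m + 1 := ⟨n - 1, by omega⟩
  have hq0 : (0 : ℝ) < q := by positivity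
  have hq2 : (2 : ℝ) ≤ q := by exact_mod_cast hq
  refine le_trans ?_ (mul_le_mul_of_nonneg_left (sum_pow_mul_le (x := 1 / q) (by positivity)
    (by rw [div_lt_one hq0]; linarith) m) (by positivity))
  rw [Finset.mul_sum]
  have hdeg : ∀ x ∈ degreeData (m + 1), ∑ k, (x.1 k : ℕ) +
      (∑ k : Fin m, ((k : ℕ) + 1) * (Fin.tail x.1 k : ℕ) + ∑ s ∈ x.2, ((s.1 : ℕ) + 1)) =
        m + 1 := by
    intro x hx
    simp only [degreeData, Finset.mem_filter, Finset.mem_univ, true_and] at hx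
    rw [Fin.sum_univ_succ] at hx ⊢
    simp only [Fin.val_zero, Fin.val_succ, add_mul, Finset.sum_add_distrib,
      one_mul, Fin.tail, zero_add] at hx ⊢
    omega
  have hinj : Set.InjOn (fun x : (Fin (m + 1) → Fin (m + 2)) × Finset (Fin (m + 1) × Bool × Bool) =>
      (Fin.tail x.1, x.2)) (degreeData (m + 1)) := by
    rintro ⟨d, S⟩ hx ⟨d', S'⟩ hx' h
    obtain ⟨h1, rfl⟩ := Prod.mk.inj h
    have h3 := hdeg _ hx
    have h4 := hdeg _ hx'
    simp only at h1 h3 h4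
    rw [← h1] at h4
    replace h4 := h4.trans h3.symm
    rw [add_left_inj, Fin.sum_univ_succ, Fin.sum_univ_succ] at h4
    have h5 : ∀ k : Fin m, d k.succ = d' k.succ := congrFun h1
    simp only [h5, add_left_inj, Fin.val_inj] at h4
    refine Prod.ext (funext fun k => ?_) rfl
    cases k using Fin.cases with
    | zero => exact h4.symm
    | succ k => exact h5 k
  refine le_trans (le_of_eq ?_) (Finset.sum_le_sum_of_subset_of_nonneg
    (Finset.subset_univ ((degreeData (m + 1)).image fun x => (Fin.tail x.1, x.2)))
    fun _ _ _ => by positivity)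
  rw [Finset.sum_image hinj]
  refine Finset.sum_congr rfl fun x hx => ?_
  rw [show (q : ℝ) ^ (m + 1) = _ from congrArg _ (hdeg x hx).symm, pow_add, mul_assoc,
    ← mul_pow, mul_one_div_cancel hq0.ne', one_pow, mul_one]

end

section

variable {F : Type u} [Field F] {n : ℕ}

theorem exists_symmetrizer {P : F[X]} (hP : P.Monic) (hd : P.natDegree = n) (hn : 0 < n) :
    ∃ M G : Matrix (Fin n) (Fin n) F, M.charpoly = P ∧ Gᵀ = G ∧ IsUnit G.det ∧ Mᵀ * G = G * M := by
  subst hd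
  let b := AdjoinRoot.powerBasisAux' hP
  let f : Module.End F (AdjoinRoot P) := Algebra.lmul F _ (AdjoinRoot.root P)
  let φ : AdjoinRoot P →ₗ[F] F := lcoeff F (P.natDegree - 1) ∘ₗ AdjoinRoot.modByMonicHom hP
  let B : LinearMap.BilinForm F (AdjoinRoot P) := (LinearMap.mul F (AdjoinRoot P)).compr₂ φ
  have hB : ∀ u v, B u v = φ (u * v) := fun _ _ => rfl
  have hsymm : ∀ u v, B u v = B v u := fun u v => by rw [hB, hB, mul_comm]
  refine ⟨LinearMap.toMatrix b b f, LinearMap.BilinForm.toMatrix b B, ?_, ?_, ?_, ?_⟩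
  · have h := charpoly_leftMulMatrix (AdjoinRoot.powerBasis' hP)
    rw [AdjoinRoot.powerBasis'_gen, AdjoinRoot.minpoly_root hP.ne_zero, hP.leadingCoeff, inv_one,
      C_1, mul_one] at h
    exact h
  · ext i j
    simp only [Matrix.transpose_apply, LinearMap.BilinForm.toMatrix_apply]
    exact hsymm _ _
  · rw [isUnit_iff_ne_zero, ← LinearMap.BilinForm.nondegenerate_iff_det_ne_zero]
    have hsep : ∀ u, (∀ v, B u v = 0) → u = 0 := fun u hu => by
      obtain ⟨p, rfl⟩ := AdjoinRoot.mk_surjective u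
      rw [AdjoinRoot.mk_eq_zero]
      refine (topCoeffMod_isFrobenius hP hn).dvd p fun r => ?_
      have h := hu (AdjoinRoot.mk P r)
      rw [hB, ← map_mul] at h
      rw [← h]
      change _ = ((AdjoinRoot.modByMonicHom hP) (AdjoinRoot.mk P (p * r))).coeff _
      rw [AdjoinRoot.modByMonicHom_mk]
      rfl
    exact ⟨hsep, fun v hv => hsep v fun u => by rw [hsymm, hv]⟩
  · rw [← LinearMap.BilinForm.toMatrix_compLeft, ← LinearMap.BilinForm.toMatrix_compRight]
    congr 1
    refine LinearMap.ext₂ fun u v => ?_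
    change φ (AdjoinRoot.root P * u * v) = φ (u * (AdjoinRoot.root P * v))
    congr 1
    ring

theorem Sp.exists_charpoly {P : F[X]} (hP : P.Monic) (hd : P.natDegree = n) (hn : 0 < n) :
    ∃ A : Sp n F, (A.1.1 + A.1⁻¹.1).charpoly = P ^ 2 := by
  obtain ⟨M, G, hM, hG, hu, hMG⟩ := exists_symmetrizer hP hd hn
  have h1 : G * G⁻¹ = 1 := Matrix.mul_nonsing_inv G hu
  have h2 : G⁻¹ * G = 1 := Matrix.nonsing_inv_mul G hu
  have h3 : G⁻¹ᵀ = G⁻¹ := by rw [Matrix.transpose_nonsing_inv, hG]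
  have h4 : G⁻¹ * Mᵀ = M * G⁻¹ := by
    calc G⁻¹ * Mᵀ = G⁻¹ * (Mᵀ * G) * G⁻¹ := by rw [mul_assoc, mul_assoc, h1, mul_one]
      _ = M * G⁻¹ := by rw [hMG, ← mul_assoc, h2, one_mul]
  let g : Matrix.GeneralLinearGroup (Fin n ⊕ Fin n) F :=
    ⟨Matrix.fromBlocks 0 (-G) G⁻¹ M, Matrix.fromBlocks Mᵀ G (-G⁻¹) 0,
      by rw [Matrix.fromBlocks_multiply, ← Matrix.fromBlocks_one]; simp [h1, h2, h4],
      by rw [Matrix.fromBlocks_multiply, ← Matrix.fromBlocks_one]; simp [h1, h2, hMG]⟩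
  refine ⟨⟨g, ?_⟩, ?_⟩
  · change (Matrix.fromBlocks 0 (-G) G⁻¹ M)ᵀ * sympJ n F * Matrix.fromBlocks 0 (-G) G⁻¹ M = _
    rw [sympJ, Matrix.fromBlocks_transpose, Matrix.fromBlocks_multiply,
      Matrix.fromBlocks_multiply]
    simp [h1, h2, h3, hG, hMG]
  · change (Matrix.fromBlocks 0 (-G) G⁻¹ M + Matrix.fromBlocks Mᵀ G (-G⁻¹) 0).charpoly = P ^ 2
    rw [Matrix.fromBlocks_add]
    simp only [zero_add, neg_add_cancel, add_neg_cancel, add_zero]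
    rw [Matrix.charpoly_fromBlocks_zero₁₂, Matrix.charpoly_transpose, hM, sq]

theorem Sp.charpoly_eq_of_isConj {A A' : Sp n F} (h : IsConj A A') :
    (A.1.1 + A.1⁻¹.1).charpoly = (A'.1.1 + A'.1⁻¹.1).charpoly := by
  obtain ⟨c, rfl⟩ := isConj_iff.1 h
  rw [← Matrix.charpoly_units_conj c.1 (A.1.1 + A.1⁻¹.1)]
  congr 1
  simp [mul_add, add_mul, mul_assoc]

theorem degree_sum_coeff_lt {d : ℕ} (a : Fin d → F) :
    (∑ i : Fin d, C (a i) * X ^ (i : ℕ)).degree < (d : WithBot ℕ) := by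
  rw [Polynomial.degree_lt_iff_coeff_zero]
  intro m hm
  simp only [finsetSum_coeff, coeff_C_mul_X_pow]
  exact Finset.sum_eq_zero fun i _ => if_neg (by omega)

theorem monicOfCoeff_monic {d : ℕ} (a : Fin d → F) : (monicOfCoeff a).Monic :=
  monic_X_pow_add (degree_sum_coeff_lt a)

theorem natDegree_monicOfCoeff {d : ℕ} (a : Fin d → F) : (monicOfCoeff a).natDegree = d :=
  by rw [monicOfCoeff, natDegree_add_eq_left_of_degree_lt (by
    rw [degree_X_pow]; exact degree_sum_coeff_lt a), natDegree_X_pow]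

theorem monicOfCoeff_injective {d : ℕ} :
    Function.Injective (monicOfCoeff : (Fin d → F) → F[X]) := by
  intro a a' h
  funext i
  have h1 := congrArg (fun p => coeff p i) h
  simpa [monicOfCoeff, coeff_X_pow, i.2.ne, finsetSum_coeff, Fin.val_inj] using h1

theorem pow_le_card_conjClasses [Fintype F] (h2 : (2 : F) ≠ 0) (hn : 0 < n) :
    Fintype.card F ^ n ≤ Nat.card (ConjClasses (Sp n F)) := by
  classical
  choose A hA using fun a : Fin n → F =>
    Sp.exists_charpoly (monicOfCoeff_monic a) (natDegree_monicOfCoeff a) hn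
  have hinj : Function.Injective fun a => ConjClasses.mk (A a) := fun a a' h => by
    have h1 := Sp.charpoly_eq_of_isConj (ConjClasses.mk_eq_mk_iff_isConj.1 h)
    rw [hA, hA] at h1
    refine monicOfCoeff_injective ((sq_eq_sq_iff_eq_or_eq_neg.1 h1).resolve_right fun h3 => h2 ?_)
    have h4 := congrArg (fun p => coeff p n) h3
    have h5 := (monicOfCoeff_monic a).coeff_natDegree
    have h6 := (monicOfCoeff_monic a').coeff_natDegree
    rw [natDegree_monicOfCoeff] at h5 h6
    simp only [coeff_neg, h5, h6] at h4
    linear_combination h4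
  have h := Nat.card_le_card_of_injective _ hinj
  simpa using h

end

end

/-- Theorem 3.13(1,2): for odd `q`,
`q^n ≤ k(Sp(2n,q)) ≤ 10.8 q^n`, `k(Sp(2n,q)) ≤ q^n + 30 q^{n-1}`, and
`k(Sp(2n,q)) ≤ q^n + 12 q^{n-1}` for `q ≥ 5`. -/
theorem stmt_12 (q : ℕ) (hq : IsPrimePow q) (hodd : Odd q)
    (F : Type*) [Field F] [Fintype F] (hF : Fintype.card F = q) (n : ℕ) (hn : 1 ≤ n) :
    ((q : ℝ) ^ n ≤ (Nat.card (ConjClasses (Sp n F)) : ℝ) ∧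
      (Nat.card (ConjClasses (Sp n F)) : ℝ) ≤ 10.8 * (q : ℝ) ^ n) ∧
    (Nat.card (ConjClasses (Sp n F)) : ℝ) ≤ (q : ℝ) ^ n + 30 * (q : ℝ) ^ (n - 1) ∧
    (5 ≤ q →
      (Nat.card (ConjClasses (Sp n F)) : ℝ) ≤ (q : ℝ) ^ n + 12 * (q : ℝ) ^ (n - 1)) := by
  have h2 : (2 : F) ≠ 0 := by
    refine Ring.two_ne_zero fun h => ?_
    rw [← Nat.not_even_iff_odd, ← hF, Nat.even_iff, ← FiniteField.even_card_iff_char_two] at hodd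
    exact hodd h
  have hq3 : 3 ≤ q := by
    obtain ⟨k, rfl⟩ := hodd
    have := hq.one_lt
    omega
  have hqr : (3 : ℝ) ≤ q := by exact_mod_cast hq3
  have hq0 : (0 : ℝ) < q := by linarith
  have hlow : (q : ℝ) ^ n ≤ (Nat.card (ConjClasses (Sp n F)) : ℝ) := by
    exact_mod_cast hF ▸ pow_le_card_conjClasses (F := F) h2 hn
  have hpow : (q : ℝ) ^ n = q * (q : ℝ) ^ (n - 1) := by
    rw [← pow_succ', Nat.sub_add_cancel hn]
  have hpos : 0 < (q : ℝ) ^ (n - 1) := by positivity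
  have hup : (Nat.card (ConjClasses (Sp n F)) : ℝ) ≤ (q : ℝ) ^ n * boundProd (1 / q) n := by
    refine le_trans ?_ (sum_degreeData_le (by omega) hn)
    exact_mod_cast hF ▸ card_conjClasses_le (F := F) (n := n) h2
  have key : ∀ r c : ℝ, 1 < r → r ≤ q → boundProd (1 / r) n ≤ 1 + c →
      (Nat.card (ConjClasses (Sp n F)) : ℝ) ≤ (q : ℝ) ^ n + r * c * (q : ℝ) ^ (n - 1) := by
    intro r c hr hrq hb
    have h := boundProd_mul_le (t := r / q) (x := 1 / r) (by positivity)
      ((div_le_one hq0).2 hrq) (by positivity) ((div_lt_one (by linarith)).2 hr) n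
    rw [div_mul_div_cancel₀' (by linarith : r ≠ 0)] at h
    have h1 : boundProd (1 / q) n ≤ 1 + r / q * c :=
      h.trans (by gcongr; linarith)
    refine (hup.trans (mul_le_mul_of_nonneg_left h1 (by positivity))).trans (le_of_eq ?_)
    rw [hpow]
    field_simp
  have h3 := key 3 9.8 (by norm_num) hqr ((boundProd_third n).trans (by norm_num))
  refine ⟨⟨hlow, h3.trans ?_⟩, h3.trans ?_, fun h5 => ?_⟩
  · rw [hpow]
    nlinarith
  · nlinarith
  · refine (key 5 2.4 (by norm_num) (by exact_mod_cast h5)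
      ((boundProd_fifth n).trans (by norm_num))).trans ?_
    nlinarith
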